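/- arXiv:2007.08288 — 3 statements merged into one kernel-verified Lean document; each statement's English description precedes it below -/
import Mathlib

section
/- Let m ≥ 3 and let A_m be the dihedral Artin group on generators s, t with exponent m. A word w = s^{i_1} t^{j_1} ⋯ s^{i_m} t^{j_m} with 2m syllables (all exponents i_1, j_1, …, i_m, j_m nonzero integers) represents the identity element of A_m if and only if, up to interchanging the roles of s and t and up to a cyclic permutation of its 2m syllables, w is the word s^k · (t s ⋯ t s) · t^{-k} · (s^{-1} t^{-1} ⋯ s^{-1} t^{-1}) when m is odd, respectively s^k · (t s ⋯ s t) · s^{-k} · (t^{-1} s^{-1} ⋯ s^{-1} t^{-1}) when m is even, where each parenthesized block is an alternating word of length m−1 whose syllables are single letters, and where k is some nonzero integer. -/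
/-- The alternating word `s t s t ⋯` of length `m`. -/
def altWord {G : Type*} [Monoid G] (s t : G) : ℕ → G
  | 0 => 1
  | n + 1 => s * altWord t s n

/-- The defining relation of the dihedral Artin group with exponent `m`,
with `false` playing the role of `s` and `true` the role of `t`. -/
def dihedralRels (m : ℕ) : Set (FreeGroup Bool) :=
  {altWord (FreeGroup.of false) (FreeGroup.of true) m *
    (altWord (FreeGroup.of true) (FreeGroup.of false) m)⁻¹}

/-- The dihedral Artin group `⟨s, t | prod(s,t;m) = prod(t,s;m)⟩`. -/
abbrev DihedralArtin (m : ℕ) := PresentedGroup (dihedralRels m)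

/-- The generators `s` (for `false`) and `t` (for `true`). -/
def gen (m : ℕ) (b : Bool) : DihedralArtin m := PresentedGroup.of b

/-- Evaluate a list of syllables `(generator, exponent)` in the dihedral Artin group. -/
def evalSyllables (m : ℕ) (L : List (Bool × ℤ)) : DihedralArtin m :=
  (L.map fun p => gen m p.1 ^ p.2).prod

/-- The list of `n` syllables with alternating generators starting with `b`,
all with exponent `e`. -/
def altList (b : Bool) (e : ℤ) : ℕ → List (Bool × ℤ)
  | 0 => []
  | n + 1 => (b, e) :: altList (!b) e n

/-- The canonical word with `2m` syllables:
`s^k (ts⋯ts) t^{-k} (s⁻¹t⁻¹⋯s⁻¹t⁻¹)` for `m` odd, and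
`s^k (ts⋯st) s^{-k} (t⁻¹s⁻¹⋯s⁻¹t⁻¹)` for `m` even,
where the parenthesized alternating blocks have length `m - 1`. -/
def canonicalWord (m : ℕ) (k : ℤ) : List (Bool × ℤ) :=
  if Odd m then
    (false, k) :: (altList true 1 (m - 1) ++ (true, -k) :: altList false (-1) (m - 1))
  else
    (false, k) :: (altList true 1 (m - 1) ++ (false, -k) :: altList true (-1) (m - 1))

/-- The syllable list of the word `s^{i₁} t^{j₁} ⋯ s^{iₘ} t^{jₘ}`. -/
def syllableList (m : ℕ) (i j : Fin m → ℤ) : List (Bool × ℤ) :=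
  (List.finRange m).flatMap fun p => [(false, i p), (true, j p)]

/-- Interchange the roles of `s` and `t` in a syllable list. -/
def swapST (L : List (Bool × ℤ)) : List (Bool × ℤ) := L.map fun p => (!p.1, p.2)

namespace DihArt

/-- Alternating syllable evaluation. -/
def F {H : Type*} [Group H] (u : Bool → H) : Bool → List ℤ → H
  | _, [] => 1
  | b, e :: es => u b ^ e * F u (!b) es

/-- Flip `b` `n` times. -/
def fl : ℕ → Bool → Bool
  | 0, b => b
  | n + 1, b => fl n (!b)

def HasRun (m : ℕ) (es : List ℤ) : Prop :=
  ∃ A p ε q B, es = A ++ p :: (List.replicate (m - 2) ε ++ q :: B) ∧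
    (ε = 1 ∨ ε = -1) ∧ 0 < p * ε ∧ 0 < q * ε

def rho : ℤ → List ℤ → ℕ
  | _, [] => 1
  | e, e' :: L => if 0 < e * e' then (if e'.natAbs = 1 then rho e' L + 1 else 2) else 1

theorem rho_pos (e : ℤ) (L : List ℤ) : 0 < rho e L := by
  cases L with
  | nil => simp [rho]
  | cons e' L => simp only [rho]; split_ifs <;> omega

theorem rho_decomp (n : ℕ) : ∀ (e : ℤ) (L : List ℤ), n + 2 ≤ rho e L →
    ∃ q B, L = List.replicate n e.sign ++ q :: B ∧ 0 < q * e.sign := by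
  induction n with
  | zero =>
    intro e L h
    cases L with
    | nil => simp [rho] at h
    | cons e' L =>
      simp only [rho] at h
      refine ⟨e', L, by simp, ?_⟩
      split_ifs at h with h1
      all_goals
        rcases lt_trichotomy e 0 with h0 | h0 | h0
        · rw [Int.sign_eq_neg_one_of_neg h0]; nlinarith
        · simp [h0] at *
        · rw [Int.sign_eq_one_of_pos h0]; nlinarith
  | succ n ih =>
    intro e L h
    cases L with
    | nil => simp [rho] at h
    | cons e' L =>
      simp only [rho] at h
      split_ifs at h with h1 h2
      · obtain ⟨q, B, rfl, hq⟩ := ih e' L (by omega)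
        have hs : e.sign = e'.sign := by
          rcases lt_trichotomy e 0 with h0 | h0 | h0
          · have : e' < 0 := by nlinarith
            rw [Int.sign_eq_neg_one_of_neg h0, Int.sign_eq_neg_one_of_neg this]
          · simp [h0] at *
          · have : 0 < e' := by nlinarith
            rw [Int.sign_eq_one_of_pos h0, Int.sign_eq_one_of_pos this]
        have he : e' = e'.sign := by
          rcases Int.natAbs_eq_iff.1 h2 with h | h <;> rw [h] <;> rfl
        refine ⟨q, B, ?_, by rw [hs]; exact hq⟩
        rw [hs, List.replicate_succ]
        simp [← he]
      · omega
      · omega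

/-! ### The free product `Z/2 * Z/m` -/

abbrev M (m : ℕ) (b : Bool) : Type := Multiplicative (ZMod (bif b then m else 2))

abbrev G (m : ℕ) := Monoid.CoprodI (M m)

def R (m : ℕ) : G m := Monoid.CoprodI.of (i := true) (Multiplicative.ofAdd (1 : ZMod m))
def S (m : ℕ) : G m := Monoid.CoprodI.of (i := false) (Multiplicative.ofAdd (1 : ZMod 2))

theorem S_sq (m : ℕ) : S m * S m = 1 := by
  unfold S
  rw [← map_mul, ← ofAdd_add]
  have : (1 + 1 : ZMod 2) = 0 := by decide
  rw [this, ofAdd_zero, map_one]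

theorem S_inv (m : ℕ) : (S m)⁻¹ = S m := inv_eq_of_mul_eq_one_left (S_sq m)

theorem R_zpow (m : ℕ) (p : ℤ) :
    R m ^ p = Monoid.CoprodI.of (i := true) (Multiplicative.ofAdd (p : ZMod m)) := by
  unfold R
  rw [← map_zpow, ← ofAdd_zsmul]
  simp

theorem R_pow_m (m : ℕ) : R m ^ m = 1 := by
  have := R_zpow m m
  rw [zpow_natCast] at this
  rw [this]
  simp

def wl (m : ℕ) : List ℤ → List (Σ b, M m b)
  | [] => []
  | p :: ps => ⟨true, Multiplicative.ofAdd (p : ZMod m)⟩ ::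
      ⟨false, Multiplicative.ofAdd (1 : ZMod 2)⟩ :: wl m ps

def toW (m : ℕ) (ps : List ℤ) (h : ∀ p ∈ ps, ¬ (m : ℤ) ∣ p) : Monoid.CoprodI.Word (M m) where
  toList := wl m ps
  ne_one := by
    induction ps with
    | nil => simp [wl]
    | cons p ps ih =>
      intro l hl
      simp only [wl, List.mem_cons] at hl
      rcases hl with rfl | rfl | hl
      · intro h0
        apply h p (by simp)
        have : (p : ZMod m) = 0 := h0
        exact (ZMod.intCast_zmod_eq_zero_iff_dvd p m).1 this |>.trans (dvd_refl _)
      · intro h0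
        have : (1 : ZMod 2) = 0 := h0
        exact absurd this (by decide)
      · exact ih (fun p hp => h p (by simp [hp])) l hl
  chain_ne := by
    induction ps with
    | nil => simp [wl]
    | cons p ps ih =>
      have := ih (fun p hp => h p (by simp [hp]))
      cases ps with
      | nil => simp [wl]
      | cons q ps =>
        simp only [wl] at this ⊢
        simpa using this

theorem toW_prod (m : ℕ) (ps : List ℤ) (h : ∀ p ∈ ps, ¬ (m : ℤ) ∣ p) :
    (toW m ps h).prod = (ps.map fun p => R m ^ p * S m).prod := by
  induction ps with
  | nil => simp [toW, wl, Monoid.CoprodI.Word.prod]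
  | cons p ps ih =>
    have := ih (fun p hp => h p (by simp [hp]))
    simp only [Monoid.CoprodI.Word.prod, toW, wl, List.map_cons, List.prod_cons] at this ⊢
    rw [this, R_zpow, mul_assoc]
    rfl

def sW (m : ℕ) : Monoid.CoprodI.Word (M m) where
  toList := [⟨false, Multiplicative.ofAdd (1 : ZMod 2)⟩]
  ne_one := by
    intro l hl
    simp only [List.mem_singleton] at hl
    subst hl
    intro h0
    have : (1 : ZMod 2) = 0 := h0
    exact absurd this (by decide)
  chain_ne := by simp

theorem word_prod_inj (m : ℕ) (w w' : Monoid.CoprodI.Word (M m)) (h : w.prod = w'.prod) :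
    w = w' := Monoid.CoprodI.Word.equiv.symm.injective h

theorem val_ne (m : ℕ) (ps : List ℤ) (hne : ps ≠ []) (h : ∀ p ∈ ps, ¬ (m : ℤ) ∣ p) :
    (ps.map fun p => R m ^ p * S m).prod ≠ 1 ∧ (ps.map fun p => R m ^ p * S m).prod ≠ S m := by
  rw [← toW_prod m ps h]
  cases ps with
  | nil => simp at hne
  | cons p ps =>
    constructor
    · intro h0
      have := word_prod_inj m _ Monoid.CoprodI.Word.empty (by rw [h0]; simp)
      have := congrArg Monoid.CoprodI.Word.toList this
      simp [toW, wl, Monoid.CoprodI.Word.empty] at this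
    · intro h0
      have := word_prod_inj m _ (sW m) (by rw [h0]; simp [sW, Monoid.CoprodI.Word.prod, S])
      have := congrArg Monoid.CoprodI.Word.toList this
      simp [toW, wl, sW] at this

/-- image of generators -/
def gi (m : ℕ) (b : Bool) : G m := bif b then S m * R m else R m * S m

def Sp (m : ℕ) (c : Bool) : G m := bif c then S m else 1

def ff (b : Bool) (e : ℤ) : Bool := xor b (decide (e < 0))

theorem Sp_sq (m : ℕ) (c : Bool) : Sp m c * Sp m c = 1 := by
  cases c <;> simp [Sp, S_sq]

theorem conj_pow' {H : Type*} [Group H] (s a : H) (hs : s * s = 1) (n : ℕ) :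
    (s * a * s) ^ n = s * a ^ n * s := by
  have : s⁻¹ = s := inv_eq_of_mul_eq_one_left hs
  conv_lhs => rw [show s * a * s = s * a * s⁻¹ by rw [this]]
  rw [conj_pow, this]

theorem gi_zpow (m : ℕ) (b : Bool) (e : ℤ) (he : e ≠ 0) :
    gi m b ^ e = Sp m (ff b e) * (R m ^ e.sign * S m) ^ e.natAbs * Sp m (ff b e) := by
  have hSS := S_sq m
  have key : ∀ a : G m, S m * (a * S m) * S m = S m * a := by
    intro a; simp [mul_assoc, hSS]
  rcases lt_or_gt_of_ne he with h | h
  · obtain ⟨n, rfl⟩ : ∃ n : ℕ, e = -(n : ℤ) := ⟨e.natAbs, by omega⟩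
    rw [zpow_neg, zpow_natCast, ← inv_pow, Int.sign_eq_neg_one_of_neg h, Int.natAbs_neg,
      Int.natAbs_natCast, zpow_neg_one]
    cases b
    · simp only [gi, ff, h, Sp, decide_true, Bool.false_xor, cond_true, cond_false, mul_inv_rev,
        S_inv]
      rw [← conj_pow' _ _ hSS, key]
    · simp only [gi, ff, h, Sp, decide_true, Bool.xor_self, cond_true, cond_false, mul_inv_rev,
        S_inv, one_mul, mul_one]
  · obtain ⟨n, rfl⟩ : ∃ n : ℕ, e = (n : ℤ) := ⟨e.natAbs, by omega⟩
    have h' : ¬ ((n : ℤ) < 0) := by omega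
    rw [zpow_natCast, Int.sign_eq_one_of_pos h, Int.natAbs_natCast, zpow_one]
    cases b
    · simp [gi, ff, Sp, h']
    · simp only [gi, ff, h', Sp, decide_false, Bool.xor_false, cond_true]
      rw [← conj_pow' _ _ hSS, key]

def val (m : ℕ) (ps : List ℤ) (c : Bool) : G m := (ps.map fun p => R m ^ p * S m).prod * Sp m c

theorem val_cons (m : ℕ) (p : ℤ) (ps : List ℤ) (c : Bool) :
    val m (p :: ps) c = R m ^ p * S m * val m ps c := by
  simp [val, mul_assoc]

theorem val_rep (m n : ℕ) (p : ℤ) (ps : List ℤ) (c : Bool) :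
    val m (List.replicate n p ++ ps) c = (R m ^ p * S m) ^ n * val m ps c := by
  simp [val, mul_assoc]

theorem sign_mul_not_dvd {m : ℕ} {e : ℤ} (he : e ≠ 0) {r : ℕ} (h0 : 0 < r) (h1 : r < m) :
    ¬ (m : ℤ) ∣ e.sign * r := by
  intro h
  have := Int.natAbs_dvd_natAbs.2 h
  rw [Int.natAbs_mul, Int.natAbs_sign_of_ne_zero he] at this
  simp at this
  exact absurd (Nat.le_of_dvd h0 this) (by omega)

def hr (e : ℤ) (L : List ℤ) : ℕ := if e.natAbs = 1 then rho e L else 1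

theorem nf_core (m : ℕ) (hm : 3 ≤ m) : ∀ (L : List ℤ) (e : ℤ) (b : Bool),
    (∀ x ∈ e :: L, x ≠ 0) → ¬ HasRun m (e :: L) →
    ∃ ps c, Sp m (ff b e) * F (gi m) b (e :: L) = val m ((e.sign * hr e L) :: ps) c ∧
      (∀ p ∈ (e.sign * hr e L) :: ps, ¬ (m : ℤ) ∣ p) := by
  intro L
  induction L with
  | nil =>
    intro e b h0 hrun
    have he : e ≠ 0 := h0 e (by simp)
    have h1 : hr e [] = 1 := by simp [hr, rho]
    have hd : ¬ (m : ℤ) ∣ e.sign := by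
      have := sign_mul_not_dvd (m := m) he (r := 1) (by omega) (by omega)
      simpa using this
    refine ⟨List.replicate (e.natAbs - 1) e.sign, ff b e, ?_, ?_⟩
    · rw [h1]
      simp only [F, Nat.cast_one, mul_one]
      rw [gi_zpow m b e he, ← List.replicate_succ, ← List.append_nil (List.replicate _ _), val_rep,
        ← mul_assoc, ← mul_assoc, Sp_sq, one_mul, Nat.sub_add_cancel (by omega)]
      simp [val]
    · rw [h1]
      intro p hp
      simp only [List.mem_cons, List.mem_replicate] at hp
      rcases hp with rfl | ⟨_, rfl⟩
      · simpa using hd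
      · exact hd
  | cons e' L ih =>
    intro e b h0 hrun
    have he : e ≠ 0 := h0 e (by simp)
    have he' : e' ≠ 0 := h0 e' (by simp)
    have hrun' : ¬ HasRun m (e' :: L) := by
      rintro ⟨A, p, ε, q, B, h, hh⟩
      exact hrun ⟨e :: A, p, ε, q, B, by rw [h]; rfl, hh⟩
    have hrho : rho e (e' :: L) < m := by
      by_contra hlt
      obtain ⟨q, B, h, hq⟩ := rho_decomp (m - 2) e (e' :: L) (by omega)
      refine hrun ⟨[], e, e.sign, q, B, by rw [h]; rfl, ?_, ?_, hq⟩
      · rcases lt_or_gt_of_ne he with h | h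
        · right; exact Int.sign_eq_neg_one_of_neg h
        · left; exact Int.sign_eq_one_of_pos h
      · rw [Int.mul_sign_self]; omega
    have hd : ¬ (m : ℤ) ∣ e.sign := by
      have := sign_mul_not_dvd (m := m) he (r := 1) (by omega) (by omega)
      simpa using this
    obtain ⟨ps, c, hps, hall⟩ := ih e' (!b) (fun x hx => h0 x (by simp at hx ⊢; tauto)) hrun'
    have start : Sp m (ff b e) * F (gi m) b (e :: e' :: L) =
        (R m ^ e.sign * S m) ^ e.natAbs * (Sp m (ff b e) * F (gi m) (!b) (e' :: L)) := by
      rw [F, gi_zpow m b e he]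
      simp only [← mul_assoc]
      rw [Sp_sq, one_mul]
    rw [start]
    by_cases hsame : 0 < e * e'
    · have hsg : e'.sign = e.sign := by
        rcases lt_or_gt_of_ne he with h | h
        · have : e' < 0 := by nlinarith
          rw [Int.sign_eq_neg_one_of_neg h, Int.sign_eq_neg_one_of_neg this]
        · have : 0 < e' := by nlinarith
          rw [Int.sign_eq_one_of_pos h, Int.sign_eq_one_of_pos this]
      have hlt : decide (e' < 0) = decide (e < 0) := by
        rcases lt_or_gt_of_ne he with h | h
        · have : e' < 0 := by nlinarith
          simp [h, this]
        · have : 0 < e' := by nlinarith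
          rw [decide_eq_decide]; omega
      have hff : Sp m (ff b e) = S m * Sp m (ff (!b) e') := by
        unfold ff
        rw [hlt]
        cases b <;> cases decide (e < 0) <;> simp [Sp, S_sq]
      have hrr : rho e (e' :: L) = hr e' L + 1 := by
        simp only [rho, hr, hsame, if_true]
        split_ifs <;> rfl
      have hmid : (R m ^ e.sign * S m) ^ e.natAbs * (Sp m (ff b e) * F (gi m) (!b) (e' :: L)) =
          (R m ^ e.sign * S m) ^ (e.natAbs - 1) *
            val m ((e.sign * rho e (e' :: L)) :: ps) c := by
        rw [hff, mul_assoc (S m), hps, val_cons, val_cons, hrr, hsg]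
        conv_lhs => rw [show e.natAbs = (e.natAbs - 1) + 1 by omega]
        rw [pow_succ]
        push_cast
        rw [show e.sign * ((hr e' L : ℤ) + 1) = e.sign + e.sign * hr e' L by ring, zpow_add]
        simp only [mul_assoc]
        congr 2
        rw [← mul_assoc (S m) (S m), S_sq, one_mul]
      have hd2 := sign_mul_not_dvd he (rho_pos e (e' :: L)) hrho
      by_cases h1 : e.natAbs = 1
      · refine ⟨ps, c, ?_, ?_⟩
        · rw [hmid]; simp [h1, hr]
        · intro p hp
          simp only [hr, h1, if_true, List.mem_cons] at hp
          rcases hp with rfl | hp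
          · exact hd2
          · exact hall p (by simp [hp])
      · refine ⟨List.replicate (e.natAbs - 2) e.sign ++ (e.sign * rho e (e' :: L)) :: ps, c, ?_, ?_⟩
        · rw [hmid]
          simp only [hr, h1, if_false, Nat.cast_one, mul_one]
          rw [← List.cons_append, ← List.replicate_succ, val_rep]
          congr 3
          omega
        · intro p hp
          simp only [hr, h1, if_false, Nat.cast_one, mul_one, List.mem_cons, List.mem_append,
            List.mem_replicate] at hp
          rcases hp with rfl | ⟨_, rfl⟩ | rfl | hp
          · exact hd
          · exact hd
          · exact hd2
          · exact hall p (by simp [hp])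
    · have hff : Sp m (ff b e) = Sp m (ff (!b) e') := by
        unfold ff
        rcases lt_or_gt_of_ne he with h | h
        · have : ¬ (e' < 0) := by intro h2; apply hsame; nlinarith
          simp only [h, this]; cases b <;> rfl
        · have h3 : (e' < 0) := by
            by_contra h2
            apply hsame
            have : 0 < e' := by omega
            positivity
          have : ¬ (e < 0) := by omega
          simp only [h3, this]; cases b <;> rfl
      have h1 : hr e (e' :: L) = 1 := by
        simp [hr, rho, hsame]
      refine ⟨List.replicate (e.natAbs - 1) e.sign ++ (e'.sign * hr e' L) :: ps, c, ?_, ?_⟩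
      · rw [hff, hps, h1, ← List.cons_append, Nat.cast_one, mul_one, ← List.replicate_succ, val_rep,
          Nat.sub_add_cancel (by omega)]
      · rw [h1]
        intro p hp
        simp only [Nat.cast_one, mul_one, List.mem_cons, List.mem_append,
            List.mem_replicate] at hp
        rcases hp with rfl | ⟨_, rfl⟩ | hp
        · exact hd
        · exact hd
        · exact hall p (by simpa using hp)

theorem nf_G (m : ℕ) (hm : 3 ≤ m) (L : List ℤ) (b : Bool) (hne : L ≠ []) (h0 : ∀ x ∈ L, x ≠ 0)
    (h : F (gi m) b L = 1 ∨ F (gi m) b L = S m) : HasRun m L := by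
  by_contra hrun
  cases L with
  | nil => simp at hne
  | cons e L =>
    obtain ⟨ps, c, h1, h2⟩ := nf_core m hm L e b h0 hrun
    obtain ⟨h3, h4⟩ := val_ne m _ (by simp) h2
    set P := (List.map (fun p => R m ^ p * S m) (e.sign * hr e L :: ps)).prod with hP
    have h5 : P = Sp m (ff b e) * F (gi m) b (e :: L) * Sp m c := by
      rw [h1, val, mul_assoc, Sp_sq, mul_one]
    have hSS := S_sq m
    rcases h with h | h <;> rw [h] at h5 <;> cases hb : ff b e <;> cases c <;>
      simp [hb, Sp, hSS] at h5 <;> first | exact h3 h5 | exact h4 h5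


/-! ### Abstract core -/

section core

variable {H : Type*} [Group H]

theorem fl_succ (n : ℕ) (b : Bool) : fl (n + 1) b = !(fl n b) := by
  induction n generalizing b with
  | zero => rfl
  | succ n ih => rw [fl, ih, fl]

theorem fl_add (n k : ℕ) (b : Bool) : fl (n + k) b = fl n (fl k b) := by
  induction n with
  | zero => rw [Nat.zero_add]; rfl
  | succ n ih => rw [Nat.add_right_comm, fl_succ, ih, fl_succ]

theorem fl_two (n : ℕ) (b : Bool) : fl (2 * n) b = b := by
  induction n with
  | zero => rfl
  | succ n ih => rw [Nat.mul_succ, fl_succ, fl_succ, ih, Bool.not_not]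

theorem fl_fl (n : ℕ) (b : Bool) : fl n (fl n b) = b := by
  rw [← fl_add, ← two_mul, fl_two]

theorem F_append (u : Bool → H) (b : Bool) (A B : List ℤ) :
    F u b (A ++ B) = F u b A * F u (fl A.length b) B := by
  induction A generalizing b with
  | nil => simp [F, fl]
  | cons e A ih => simp [F, fl, ih, mul_assoc]

theorem F_inv (u : Bool → H) (b : Bool) (A : List ℤ) :
    F (fun b => (u b)⁻¹) b A = F u b (A.map (- ·)) := by
  induction A generalizing b with
  | nil => simp [F]
  | cons e A ih => simp [F, ih]

theorem F_map {K : Type*} [Group K] (φ : H →* K) (u : Bool → H) (b : Bool) (A : List ℤ) :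
    φ (F u b A) = F (fun b => φ (u b)) b A := by
  induction A generalizing b with
  | nil => simp [F]
  | cons e A ih => simp [F, ih]

theorem F_rep_inv (u : Bool → H) (n : ℕ) (b : Bool) :
    F u b (List.replicate n 1) * F u (fl (n + 1) b) (List.replicate n (-1)) = 1 := by
  induction n generalizing b with
  | zero => simp [F]
  | succ n ih =>
    rw [List.replicate_succ, List.replicate_succ' (a := (-1 : ℤ)), F_append, F]
    have h1 : fl (n + 1 + 1) b = fl (n + 1) (!b) := rfl
    have h2 : fl n (fl (n + 1 + 1) b) = b := by
      rw [← fl_add, show n + (n + 1 + 1) = 2 * (n + 1) by ring, fl_two]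
    have := ih (!b)
    rw [List.length_replicate, h2, h1]
    simp only [F, mul_one, zpow_one]
    rw [mul_assoc, ← mul_assoc (F _ _ _), this]
    simp

structure Good (m : ℕ) (u : Bool → H) (D : H) : Prop where
  h1 : ∀ b, F u b (List.replicate m 1) = D
  hn : ∀ b, F u b (List.replicate m (-1)) = D⁻¹
  nf : ∀ b es (k : ℤ), es ≠ [] → (∀ x ∈ es, x ≠ 0) → F u b es = D ^ k → HasRun m es
  deg : ∀ b es (k : ℤ), F u b es = D ^ k → es.sum = m * k

theorem HasRun.neg {m : ℕ} {es : List ℤ} (h : HasRun m (es.map (- ·))) : HasRun m es := by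
  obtain ⟨A, p, ε, q, B, h, hε, hp, hq⟩ := h
  refine ⟨A.map (- ·), -p, -ε, -q, B.map (- ·), ?_, by omega, by linarith, by linarith⟩
  have := congrArg (List.map (- ·)) h
  simpa [Function.comp_def] using this

theorem Good.inv {m : ℕ} {u : Bool → H} {D : H} (g : Good m u D) :
    Good m (fun b => (u b)⁻¹) D⁻¹ where
  h1 b := by rw [F_inv]; simpa using g.hn b
  hn b := by rw [F_inv]; simpa using g.h1 b
  nf b es k hne h0 h := by
    rw [F_inv, inv_zpow, ← zpow_neg] at h
    exact (g.nf b _ (-k) (by simpa using hne) (by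
      intro x hx
      obtain ⟨y, hy, rfl⟩ := List.mem_map.1 hx
      exact neg_ne_zero.2 (h0 y hy)) h).neg
  deg b es k h := by
    rw [F_inv, inv_zpow, ← zpow_neg] at h
    have := g.deg b _ _ h
    have h2 : (es.map (- ·)).sum = - es.sum := by
      clear * -
      induction es with
      | nil => simp
      | cons e es ih => simp only [List.map_cons, List.sum_cons, ih]; ring
    rw [h2] at this
    linarith

variable {m : ℕ} {u : Bool → H} {D : H}

theorem comm0 (h1 : ∀ b, F u b (List.replicate m 1) = D) (b : Bool) :
    D * u b = u (fl m b) * D := by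
  have e1 : F u (fl m b) (List.replicate (m + 1) 1) = u (fl m b) * D := by
    rw [List.replicate_succ, F, h1, zpow_one]
  have e2 : F u (fl m b) (List.replicate (m + 1) 1) = D * u b := by
    rw [List.replicate_succ', F_append, h1, List.length_replicate, fl_fl]
    simp [F]
  rw [← e1, ← e2]

theorem comm1 (h1 : ∀ b, F u b (List.replicate m 1) = D) (b : Bool) (z : ℤ) :
    D * u b ^ z = u (fl m b) ^ z * D := by
  have h : SemiconjBy D (u b) (u (fl m b)) := comm0 h1 b
  exact h.zpow_right z

theorem comm2 (h1 : ∀ b, F u b (List.replicate m 1) = D) (b : Bool) (z : ℤ) :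
    D⁻¹ * u b ^ z = u (fl m b) ^ z * D⁻¹ := by
  have h : SemiconjBy D (u (fl m b)) (u b) := by
    have := comm0 h1 (fl m b)
    rwa [fl_fl] at this
  exact (SemiconjBy.inv_symm_left h).zpow_right z

theorem comm_eps (h1 : ∀ b, F u b (List.replicate m 1) = D) (b : Bool) (z ε : ℤ)
    (hε : ε = 1 ∨ ε = -1) :
    D ^ ε * u b ^ z = u (fl m b) ^ z * D ^ ε := by
  rcases hε with rfl | rfl
  · simpa using comm1 h1 b z
  · simpa using comm2 h1 b z

theorem runF (g : Good m u D) (hm : 3 ≤ m) (b : Bool) (p q ε : ℤ) (hε : ε = 1 ∨ ε = -1)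
    (B : List ℤ) :
    F u b (p :: (List.replicate (m - 2) ε ++ q :: B)) =
      u b ^ (p - ε) * u (!b) ^ (q - ε) * D ^ ε * F u (fl m b) B := by
  have hl : fl (m - 2) (!b) = fl m (!b) := by
    have := fl_add (m - 2) 2 (!b)
    rw [Nat.sub_add_cancel (by omega)] at this
    rw [this, fl_two 1]
  have hD : F u b (List.replicate m ε) = D ^ ε := by
    rcases hε with rfl | rfl
    · simpa using g.h1 b
    · simpa using g.hn b
  have hrep : List.replicate m ε = ε :: (List.replicate (m - 2) ε ++ [ε]) := by
    rw [← List.replicate_succ', ← List.replicate_succ]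
    congr 1; omega
  rw [hrep] at hD
  have e1 : fl m b = !(fl m (!b)) := by
    rw [← fl_succ, fl]; simp
  simp only [F, F_append, List.length_replicate, hl, mul_one] at hD ⊢
  rw [mul_assoc (u b ^ (p - ε))]
  have e2 := comm_eps g.h1 (fl m (!b)) (q - ε) ε hε
  rw [fl_fl] at e2
  rw [← e2, ← hD, e1]
  have a1 : u b ^ p = u b ^ (p - ε) * u b ^ ε := by rw [← zpow_add, sub_add_cancel]
  have a2 : u (fl m !b) ^ q = u (fl m !b) ^ ε * u (fl m !b) ^ (q - ε) := by
    rw [← zpow_add, add_sub_cancel]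
  rw [a1, a2]
  simp only [mul_assoc]

theorem HasRun.len {es : List ℤ} (hm : 3 ≤ m) (h : HasRun m es) : m ≤ es.length := by
  obtain ⟨A, p, ε, q, B, rfl, -⟩ := h
  simp; omega

theorem run3 (hm : 3 ≤ m) {p q r : ℤ} (h : HasRun m [p, q, r]) :
    (0 < p ∧ 0 < q ∧ 0 < r) ∨ (p < 0 ∧ q < 0 ∧ r < 0) := by
  have hl := h.len hm
  simp at hl
  obtain rfl : m = 3 := by omega
  obtain ⟨A, p', ε, q', B, h, hε, hp, hq⟩ := h
  have := congrArg List.length h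
  simp at this
  have hA : A = [] := List.length_eq_zero_iff.1 (by omega)
  have hB : B = [] := List.length_eq_zero_iff.1 (by omega)
  subst hA hB
  simp at h
  obtain ⟨rfl, rfl, rfl⟩ := h
  rcases hε with rfl | rfl
  · left; omega
  · right; omega

theorem run4 (hm : 3 ≤ m) {p q r w : ℤ} (h : HasRun m [p, q, r, w]) :
    (0 < p ∧ 0 < q ∧ 0 < r) ∨ (p < 0 ∧ q < 0 ∧ r < 0) ∨
    (m = 3 ∧ 0 < q ∧ r = 1 ∧ 0 < w) ∨ (q < 0 ∧ r < 0 ∧ w < 0) := by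
  have hl := h.len hm
  simp at hl
  obtain ⟨A, p', ε, q', B, h, hε, hp, hq⟩ := h
  have hlen := congrArg List.length h
  simp at hlen
  obtain rfl | rfl : m = 3 ∨ m = 4 := by omega
  · rcases A with _ | ⟨x, _ | ⟨y, A⟩⟩
    · simp at h
      obtain ⟨rfl, rfl, rfl, _⟩ := h
      rcases hε with rfl | rfl
      · left; omega
      · right; left; omega
    · simp at h
      obtain ⟨rfl, rfl, rfl, rfl, _⟩ := h
      rcases hε with rfl | rfl
      · right; right; left; omega
      · right; right; right; omega
    · simp at hlen; omega
  · have hA : A = [] := List.length_eq_zero_iff.1 (by omega)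
    subst hA
    simp [List.replicate_succ] at h
    obtain ⟨rfl, rfl, rfl, rfl, _⟩ := h
    rcases hε with rfl | rfl
    · left; omega
    · right; left; omega

theorem SL1 (g : Good m u D) (hm : 3 ≤ m) (b : Bool) (p k : ℤ) (h : u b ^ p = D ^ k) : p = 0 := by
  by_contra hp
  have := (g.nf b [p] k (by simp) (by simpa using hp) (by simpa [F] using h)).len hm
  simp at this; omega

theorem SL2 (g : Good m u D) (hm : 3 ≤ m) (b : Bool) (p q k : ℤ)
    (h : u b ^ p * u (!b) ^ q = D ^ k) : p = 0 ∧ q = 0 := by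
  by_cases hp : p = 0
  · subst hp
    exact ⟨rfl, SL1 g hm (!b) q k (by simpa using h)⟩
  by_cases hq : q = 0
  · subst hq
    exact ⟨SL1 g hm b p k (by simpa using h), rfl⟩
  exfalso
  have := (g.nf b [p, q] k (by simp) (by simp [hp, hq]) (by simpa [F] using h)).len hm
  simp at this; omega

theorem SL3 (g : Good m u D) (hm : 3 ≤ m) (b : Bool) (p q r k : ℤ)
    (h : u b ^ p * u (!b) ^ q * u b ^ r = D ^ k) :
    (q = 0 ∧ p + r = 0) ∨ (0 < p ∧ 0 < q ∧ 0 < r) ∨ (p < 0 ∧ q < 0 ∧ r < 0) := by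
  by_cases hp : p = 0
  · subst hp
    have := SL2 g hm (!b) q r k (by simpa using h)
    left; omega
  by_cases hr : r = 0
  · subst hr
    have := SL2 g hm b p q k (by simpa using h)
    left; omega
  by_cases hq : q = 0
  · subst hq
    have := SL1 g hm b (p + r) k (by rw [zpow_add]; simpa using h)
    left; omega
  right
  exact run3 hm (g.nf b [p, q, r] k (by simp) (by simp [hp, hq, hr])
    (by simpa [F, mul_assoc] using h))

theorem SL4 (g : Good m u D) (hm : 3 ≤ m) (b : Bool) (p q r w k : ℤ)
    (hp : p ≠ 0) (hw : w ≠ 0)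
    (h : u b ^ p * u (!b) ^ q * u b ^ r * u (!b) ^ w = D ^ k) :
    (0 < p ∧ 0 < q ∧ 0 < r) ∨ (p < 0 ∧ q < 0 ∧ r < 0) ∨
    (m = 3 ∧ 0 < q ∧ r = 1 ∧ 0 < w) ∨ (q < 0 ∧ r < 0 ∧ w < 0) := by
  by_cases hr : r = 0
  · subst hr
    have := SL2 g hm b p (q + w) k (by rw [zpow_add]; simpa [mul_assoc] using h)
    omega
  by_cases hq : q = 0
  · subst hq
    have := SL2 g hm b (p + r) w k (by rw [zpow_add]; simpa using h)
    omega
  exact run4 hm (g.nf b [p, q, r, w] k (by simp) (by simp [hp, hq, hr, hw])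
    (by simpa [F, mul_assoc] using h))

theorem SLA (g : Good m u D) (hm : 3 ≤ m) (b : Bool) (p q r w k : ℤ)
    (hr : 0 ≤ r) (hw : 0 ≤ w) (hk : k < 0)
    (h : u b ^ p * u (!b) ^ q * u b ^ r * u (!b) ^ w = D ^ k) : False := by
  have hs := g.deg b [p, q, r, w] k (by simpa [F, mul_assoc] using h)
  simp at hs
  have hmk : (m : ℤ) * k < 0 := mul_neg_of_pos_of_neg (by omega) hk
  by_cases hw0 : w = 0
  · subst hw0
    have := SL3 g hm b p q r k (by simpa using h)
    omega
  by_cases hp0 : p = 0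
  · subst hp0
    have := SL3 g hm (!b) q r w k (by simpa using h)
    omega
  rcases SL4 g hm b p q r w k hp0 hw0 h with h1 | h1 | h1 | h1
  · omega
  · omega
  · obtain ⟨rfl, hq, rfl, hw⟩ := h1
    have e2 := runF g hm (!b) q w 1 (Or.inl rfl) []
    simp only [Nat.reduceSub, List.replicate_one, List.singleton_append, F, Bool.not_not,
      mul_one] at e2
    have := SL3 g hm b p (q - 1) (w - 1) (k - 1) (by
      rw [zpow_sub D, ← h, mul_assoc _ (u b ^ (1 : ℤ)), mul_assoc (u b ^ p) _ (_ * _), e2]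
      simp [mul_assoc])
    omega
  · omega

theorem SLB (g : Good m u D) (hm : 3 ≤ m) (b : Bool) (p q r w : ℤ)
    (hp : p ≤ 0) (hq : q ≤ 0) (hr : 0 < r) (hw : 0 ≤ w)
    (h : u b ^ p * u (!b) ^ q * u b ^ r * u (!b) ^ w = 1) : q = 0 ∧ w = 0 ∧ p + r = 0 := by
  rw [← zpow_zero D] at h
  by_cases hw0 : w = 0
  · subst hw0
    have := SL3 g hm b p q r 0 (by simpa using h)
    omega
  by_cases hp0 : p = 0
  · subst hp0
    have := SL3 g hm (!b) q r w 0 (by simpa using h)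
    omega
  have := SL4 g hm b p q r w 0 hp0 hw0 h
  omega

theorem sum_nonneg' {l : List ℤ} (h : ∀ x ∈ l, 0 ≤ x) : 0 ≤ l.sum := List.sum_nonneg h

theorem core (g : Good m u D) (hm : 3 ≤ m) (b : Bool) (a c : ℤ) (v : List ℤ)
    (ha : 0 < a) (hc : 0 < c) (hv : v.length = m) (hv0 : ∀ x ∈ v, x ≠ 0)
    (h : F u b (a :: (List.replicate (m - 2) 1 ++ c :: v)) = 1) :
    (c = 1 ∧ v = -a :: List.replicate (m - 1) (-1)) ∨
    (a = 1 ∧ v = List.replicate (m - 1) (-1) ++ [-c]) := by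
  rw [runF g hm b a c 1 (Or.inl rfl)] at h
  obtain ⟨b', hb'⟩ : ∃ b', b' = fl m b := ⟨_, rfl⟩
  have hbb : fl m b' = b := by rw [hb', fl_fl]
  rw [← hb'] at h
  have hE : F u b' v * u b ^ (a - 1) * u (!b) ^ (c - 1) = D⁻¹ := by
    have : F u b' v = (u b ^ (a - 1) * u (!b) ^ (c - 1) * D ^ (1 : ℤ))⁻¹ :=
      (inv_eq_of_mul_eq_one_right h).symm
    rw [this]; group
  clear h
  by_cases ha1 : a = 1
  · right
    refine ⟨ha1, ?_⟩
    subst ha1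
    rcases List.eq_nil_or_concat v with rfl | ⟨v0, z, rfl⟩
    · simp at hv; omega
    simp only [List.concat_eq_append, List.length_append, List.length_singleton] at hv hE hv0 ⊢
    have hl : fl v0.length b' = !b := by
      rw [← hbb, ← hv, fl_succ, Bool.not_not]
    have hE2 : F u b' (v0 ++ [z + (c - 1)]) = D⁻¹ := by
      rw [← hE]
      simp only [F_append, F, hl, mul_one, zpow_add]
      simp [mul_assoc]
    have hz : z + (c - 1) ≠ 0 := by
      intro hz
      rw [hz, F_append] at hE2
      have := (g.nf b' v0 (-1) (by rintro rfl; simp at hv; omega)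
        (fun x hx => hv0 x (by simp [hx])) (by simpa [F] using hE2)).len hm
      omega
    have hrun := g.nf b' (v0 ++ [z + (c - 1)]) (-1) (by simp)
      (by
        intro x hx
        simp only [List.mem_append, List.mem_singleton] at hx
        rcases hx with hx | rfl
        · exact hv0 x (by simp [hx])
        · exact hz) (by simpa using hE2)
    have hdeg := g.deg b' _ (-1) (by simpa using hE2)
    obtain ⟨A, p, ε, q, B, hr, hε, hp, hq⟩ := hrun
    have hlen := congrArg List.length hr
    simp at hlen
    have hA : A = [] := List.length_eq_zero_iff.1 (by omega)
    have hB : B = [] := List.length_eq_zero_iff.1 (by omega)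
    subst hA hB
    rw [List.nil_append] at hr
    rw [hr] at hdeg hE2
    rw [runF g hm b' p q ε hε] at hE2
    rcases hε with rfl | rfl
    · simp at hdeg
      have : (0 : ℤ) ≤ ((m - 2 : ℕ) : ℤ) := by positivity
      omega
    · have := SL2 g hm b' (p - -1) (q - -1) 0 (by
        simp only [F, mul_one, zpow_neg, zpow_one] at hE2
        have h3 := mul_eq_right.1 hE2
        simpa using h3)
      have hp1 : p = -1 := by omega
      have hq1 : q = -1 := by omega
      subst hp1 hq1
      rw [← List.cons_append, ← List.replicate_succ] at hr
      have := List.append_inj' hr rfl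
      obtain ⟨h1, h2⟩ := this
      simp at h2
      rw [h1]
      congr 2
      · omega
      · omega
  · left
    obtain ⟨T, hT⟩ : ∃ T : List ℤ, T = if c = 1 then [a - 1] else [a - 1, c - 1] := ⟨_, rfl⟩
    have hFT : F u b' (v ++ T) = D⁻¹ := by
      rw [← hE, F_append, hv, hbb, hT]
      split_ifs with h
      · simp [F, h]
      · simp [F, mul_assoc]
    have hT0 : ∀ x ∈ T, 0 < x := by
      rw [hT]; split_ifs with h
      · simp; omega
      · simp; omega
    have hrun := g.nf b' (v ++ T) (-1) (by rw [hT]; split_ifs <;> simp)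
      (by
        intro x hx
        rcases List.mem_append.1 hx with hx | hx
        · exact hv0 x hx
        · exact (hT0 x hx).ne') (by simpa using hFT)
    have hdeg := g.deg b' _ (-1) (by simpa using hFT)
    obtain ⟨A, p, ε, q, B, hr, hε, hp, hq⟩ := hrun
    have hlen := congrArg List.length hr
    simp at hlen
    have hTl : T.length = 1 ∨ T.length = 2 := by
      rw [hT]; split_ifs <;> simp
    rcases A with _ | ⟨x, _ | ⟨y, _ | ⟨z, A⟩⟩⟩
    · rw [List.nil_append, show p :: (List.replicate (m - 2) ε ++ q :: B) =
        (p :: (List.replicate (m - 2) ε ++ [q])) ++ B by simp] at hr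
      obtain ⟨hv1, hTB⟩ := List.append_inj hr (by simp; omega)
      rcases hε with rfl | rfl
      · exfalso
        have h0 : 0 ≤ T.sum := List.sum_nonneg (fun x hx => (hT0 x hx).le)
        rw [List.sum_append, hv1] at hdeg
        simp at hdeg
        omega
      · have hFv : F u b' v = u b' ^ (p - -1) * u (!b') ^ (q - -1) * D⁻¹ := by
          rw [hv1, runF g hm b' p q (-1) (Or.inr rfl)]; simp [F]
        have hb2 : fl m b = b' := hb'.symm
        have hb3 : fl m (!b) = !b' := by
          rw [← hb2, ← fl_succ]; rfl
        have h5 : u b' ^ (p - -1) * u (!b') ^ (q - -1) * u b' ^ (a - 1) * u (!b') ^ (c - 1) = 1 := by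
          have e1 := comm2 g.h1 b (a - 1)
          have e2 := comm2 g.h1 (!b) (c - 1)
          rw [hb2] at e1
          rw [hb3] at e2
          rw [hFv, mul_assoc _ D⁻¹, e1, mul_assoc, mul_assoc (u b' ^ (a - 1)), e2,
            ← mul_assoc, ← mul_assoc] at hE
          simpa using hE
        have h6 := SLB g hm b' _ _ _ _ (by omega) (by omega) (by omega) (by omega) h5
        refine ⟨by omega, ?_⟩
        have hp1 : p = -a := by omega
        have hq1 : q = -1 := by omega
        rw [hv1, hp1, hq1, ← List.replicate_succ']
        congr 2
        omega
    · exfalso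
      have hq0 : 0 < q := by
        rw [show [x] ++ p :: (List.replicate (m - 2) ε ++ q :: B) =
          ([x] ++ p :: (List.replicate (m - 2) ε)) ++ q :: B by simp] at hr
        have := (List.append_inj hr (by simp; omega)).2
        exact hT0 q (by rw [this]; simp)
      have hB0 : ∀ x ∈ B, 0 < x := by
        rw [show [x] ++ p :: (List.replicate (m - 2) ε ++ q :: B) =
          ([x] ++ p :: (List.replicate (m - 2) ε)) ++ q :: B by simp] at hr
        have := (List.append_inj hr (by simp; omega)).2
        intro y hy
        exact hT0 y (by rw [this]; simp [hy])
      rcases hε with rfl | rfl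
      swap
      · omega
      have hb2 : fl m (fl m (!b')) = !b' := fl_fl _ _
      rw [hr, List.singleton_append, F, runF g hm _ p q 1 (Or.inl rfl), Bool.not_not] at hFT
      rcases B with _ | ⟨w, _ | ⟨w', B⟩⟩
      · refine SLA g hm b' x (p - 1) (q - 1) 0 (-2) (by omega) (by omega) (by omega) ?_
        simp only [F, mul_one, zpow_one, ← mul_assoc] at hFT
        rw [zpow_zero, mul_one, eq_mul_inv_of_mul_eq hFT]
        group
      · have hw := hB0 w (by simp)
        refine SLA g hm b' x (p - 1) (q - 1) w (-2) (by omega) (by omega) (by omega) ?_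
        have e1 := comm1 g.h1 (fl m (!b')) w
        rw [hb2] at e1
        simp only [F, mul_one, zpow_one] at hFT
        rw [mul_assoc _ D, e1] at hFT
        simp only [← mul_assoc] at hFT
        rw [eq_mul_inv_of_mul_eq hFT]
        group
      · simp at hlen; omega
    · exfalso
      have hB : B = [] := List.length_eq_zero_iff.1 (by simp at hlen; omega)
      subst hB
      have hq0 : 0 < q := by
        rw [show [x, y] ++ p :: (List.replicate (m - 2) ε ++ [q]) =
          ([x, y] ++ p :: (List.replicate (m - 2) ε)) ++ [q] by simp] at hr
        have h2 : T.length = 2 := by simp at hlen; omega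
        have hq : q ∈ T := by
          obtain ⟨t1, t2, rfl⟩ := List.length_eq_two.1 h2
          rw [show v ++ [t1, t2] = (v ++ [t1]) ++ [t2] by simp] at hr
          have := (List.append_inj' hr rfl).2
          simp at this
          simp [this]
        exact hT0 q hq
      rcases hε with rfl | rfl
      swap
      · omega
      rw [hr, show [x, y] ++ p :: (List.replicate (m - 2) 1 ++ [q]) =
        x :: y :: (p :: (List.replicate (m - 2) 1 ++ [q])) by simp, F, F,
        runF g hm _ p q 1 (Or.inl rfl), Bool.not_not] at hFT
      refine SLA g hm b' x y (p - 1) (q - 1) (-2) (by omega) (by omega) (by omega) ?_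
      simp only [F, mul_one, zpow_one, ← mul_assoc] at hFT
      rw [eq_mul_inv_of_mul_eq hFT]
      group
    · simp at hlen; omega

/-- exponents of the canonical word -/
def cn (m : ℕ) (k : ℤ) : List ℤ :=
  k :: (List.replicate (m - 1) 1 ++ -k :: List.replicate (m - 1) (-1))

theorem F_rot (u : Bool → H) (b : Bool) (A X : List ℤ) (n : ℕ) (hl : (A ++ X).length = 2 * n) :
    F u b (A ++ X) = 1 ↔ F u (fl A.length b) (X ++ A) = 1 := by
  have : fl X.length (fl A.length b) = b := by
    rw [← fl_add, add_comm, ← List.length_append, hl, fl_two]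
  rw [F_append, F_append, this, mul_eq_one_iff_eq_inv, mul_eq_one_iff_inv_eq, eq_comm]

theorem cn_trivial (hm : 3 ≤ m) (h1 : ∀ b, F u b (List.replicate m 1) = D) (b : Bool) (k : ℤ) :
    F u b (cn m k) = 1 := by
  have hn : ∀ b, F u b (List.replicate m (-1)) = D⁻¹ := by
    intro b
    have := F_rep_inv u m (fl (m + 1) b)
    rw [h1, fl_fl] at this
    exact (inv_eq_of_mul_eq_one_right this).symm
  have e1 : ∀ b, F u (!b) (List.replicate (m - 1) 1) = (u b)⁻¹ * D := by
    intro b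
    have := h1 b
    rw [show m = (m - 1) + 1 by omega, List.replicate_succ, F] at this
    rw [← this]; simp
  have e2 : ∀ b, F u (!b) (List.replicate (m - 1) (-1)) = u b * D⁻¹ := by
    intro b
    have := hn b
    rw [show m = (m - 1) + 1 by omega, List.replicate_succ, F] at this
    rw [← this]; simp
  have e3 : fl (m - 1) (!b) = fl m b := by
    have : fl (m - 1 + 1) b = fl (m - 1) (!b) := rfl
    rw [← this, Nat.sub_add_cancel (by omega)]
  rw [cn, F, F_append, List.length_replicate, e3, F, e1, e2]
  have c1 := comm1 h1 (fl m b) (-k)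
  have c2 := comm1 h1 (fl m b) 1
  rw [fl_fl, zpow_one, zpow_one] at c2
  rw [fl_fl] at c1
  simp only [mul_assoc]
  rw [← mul_assoc D, c1, mul_assoc (u b ^ (-k)), ← mul_assoc D, c2]
  group

theorem main_fwd (g : Good m u D) (hm : 3 ≤ m) (b : Bool) (es : List ℤ) (hl : es.length = 2 * m)
    (h0 : ∀ x ∈ es, x ≠ 0) (h : F u b es = 1) : ∃ k : ℤ, k ≠ 0 ∧ es ~r cn m k := by
  obtain ⟨A, p, ε, q, B, rfl, hε, hp, hq⟩ := g.nf b es 0 (by rintro rfl; simp at hl; omega) h0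
    (by simpa using h)
  rw [F_rot u b _ _ m hl] at h
  have hrot : (A ++ p :: (List.replicate (m - 2) ε ++ q :: B)) ~r
      (p :: (List.replicate (m - 2) ε ++ q :: B)) ++ A := List.isRotated_append
  have hlen : (B ++ A).length = m := by simp at hl ⊢; omega
  have hv0 : ∀ x ∈ B ++ A, x ≠ 0 := by
    intro x hx
    exact h0 x (by simp at hx ⊢; tauto)
  have hre : (p :: (List.replicate (m - 2) ε ++ q :: B)) ++ A =
      p :: (List.replicate (m - 2) ε ++ q :: (B ++ A)) := by simp
  rw [hre] at h hrot
  generalize B ++ A = v at *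
  have hrr : ∀ x : ℤ, List.replicate (m - 2) x ++ [x] = List.replicate (m - 1) x := by
    intro x
    rw [← List.replicate_succ']; congr 1; omega
  have hrr2 : ∀ x : ℤ, x :: List.replicate (m - 2) x = List.replicate (m - 1) x := by
    intro x
    rw [← List.replicate_succ]; congr 1; omega
  rcases hε with rfl | rfl
  · rcases core g hm _ p q v (by omega) (by omega) hlen hv0 h with ⟨rfl, rfl⟩ | ⟨rfl, rfl⟩
    · refine ⟨p, by omega, hrot.trans ?_⟩
      rw [show ∀ X : List ℤ, List.replicate (m - 2) (1 : ℤ) ++ 1 :: X =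
        (List.replicate (m - 2) (1 : ℤ) ++ [1]) ++ X by simp, hrr]
      exact List.IsRotated.refl _
    · refine ⟨-q, by omega, hrot.trans ?_⟩
      rw [← List.cons_append, hrr2, ← List.cons_append, ← List.append_assoc]
      refine List.isRotated_append.trans ?_
      simp only [cn, List.cons_append, List.append_assoc, List.nil_append, neg_neg]
      exact List.IsRotated.refl _
  · have hneg := g.inv
    have h' : F (fun b => (u b)⁻¹) (fl A.length b)
        ((-p) :: (List.replicate (m - 2) 1 ++ (-q) :: v.map (- ·))) = 1 := by
      rw [F_inv]
      simpa [Function.comp_def] using h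
    have hmap : ∀ l : List ℤ, v.map (- ·) = l → v = l.map (- ·) := by
      rintro l rfl; simp [Function.comp_def]
    rcases core hneg hm _ (-p) (-q) (v.map (- ·)) (by omega) (by omega) (by simpa using hlen)
      (by
        intro x hx
        obtain ⟨y, hy, rfl⟩ := List.mem_map.1 hx
        exact neg_ne_zero.2 (hv0 y hy)) h' with ⟨h1, h2⟩ | ⟨h1, h2⟩
    · obtain rfl : q = -1 := by omega
      have hv := hmap _ h2
      simp at hv
      refine ⟨-p, by omega, hrot.trans ?_⟩
      rw [hv, show ∀ X : List ℤ, List.replicate (m - 2) (-1 : ℤ) ++ -1 :: X =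
        (List.replicate (m - 2) (-1 : ℤ) ++ [-1]) ++ X by simp, hrr, ← List.cons_append]
      refine List.isRotated_append.trans ?_
      simp only [cn, List.cons_append, List.append_assoc, List.nil_append, neg_neg]
      exact List.IsRotated.refl _
    · obtain rfl : p = -1 := by omega
      have hv := hmap _ h2
      simp at hv
      refine ⟨q, by omega, hrot.trans ?_⟩
      rw [← List.cons_append, hrr2, hv]
      refine List.IsRotated.trans (l' := [-q] ++ List.replicate (m - 1) (-1) ++
        (q :: List.replicate (m - 1) 1)) ?_ ?_
      · rw [← List.cons_append, ← List.append_assoc, List.append_assoc [-q]]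
        exact List.isRotated_append
      · refine List.isRotated_append.trans ?_
        simp only [cn, List.cons_append, List.append_assoc, List.nil_append, neg_neg]
        exact List.IsRotated.refl _

end core

/-! ### The dihedral Artin group -/

theorem map_altWord {H K : Type*} [Group H] [Group K] (φ : H →* K) (n : ℕ) (s t : H) :
    φ (altWord s t n) = altWord (φ s) (φ t) n := by
  induction n generalizing s t with
  | zero => simp [altWord]
  | succ n ih => simp [altWord, ih]

theorem F_altWord {H : Type*} [Group H] (u : Bool → H) (n : ℕ) (b : Bool) :
    F u b (List.replicate n 1) = altWord (u b) (u (!b)) n := by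
  induction n generalizing b with
  | zero => simp [F, altWord]
  | succ n ih => simp [List.replicate_succ, F, altWord, ih]

theorem rel_gen (m : ℕ) :
    altWord (gen m false) (gen m true) m = altWord (gen m true) (gen m false) m := by
  have h := PresentedGroup.one_of_mem (rels := dihedralRels m) (x := _) (Set.mem_singleton _)
  rw [map_mul, map_inv, mul_inv_eq_one, map_altWord, map_altWord] at h
  exact h

def Dl (m : ℕ) : DihedralArtin m := altWord (gen m false) (gen m true) m

theorem Dl_eq (m : ℕ) (b : Bool) : F (gen m) b (List.replicate m 1) = Dl m := by
  rw [F_altWord]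
  cases b
  · rfl
  · exact (rel_gen m).symm

theorem alt_gi (m n : ℕ) :
    altWord (gi m false) (gi m true) n = R m ^ n * S m ^ n ∧
    altWord (gi m true) (gi m false) n = S m * R m ^ n * S m ^ (n + 1) := by
  induction n with
  | zero => simp [altWord, S_sq]
  | succ n ih =>
    have hS : S m ^ (n + 1 + 1) = S m ^ n := by
      rw [pow_succ, pow_succ, mul_assoc, S_sq, mul_one]
    constructor
    · rw [altWord, ih.2, gi]
      simp only [cond_false, mul_assoc]
      rw [← mul_assoc (S m) (S m), S_sq, one_mul, pow_succ' (R m), mul_assoc]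
    · rw [altWord, ih.1, gi, hS, pow_succ' (R m)]
      simp only [cond_true, mul_assoc]

theorem alt_gi_m (m : ℕ) (b : Bool) : altWord (gi m b) (gi m (!b)) m = S m ^ m := by
  cases b
  · rw [Bool.not_false, (alt_gi m m).1, R_pow_m, one_mul]
  · rw [Bool.not_true, (alt_gi m m).2, R_pow_m, mul_one, ← pow_succ', pow_succ, pow_succ, mul_assoc,
      S_sq, mul_one]

def phi (m : ℕ) : DihedralArtin m →* G m :=
  PresentedGroup.toGroup (f := gi m) (by
    intro r hr
    rw [dihedralRels, Set.mem_singleton_iff] at hr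
    subst hr
    rw [map_mul, map_inv, mul_inv_eq_one, map_altWord, map_altWord, FreeGroup.lift_apply_of,
      FreeGroup.lift_apply_of]
    exact (alt_gi_m m false).trans (alt_gi_m m true).symm)

theorem phi_gen (m : ℕ) (b : Bool) : phi m (gen m b) = gi m b :=
  PresentedGroup.toGroup.of _

def dg (m : ℕ) : DihedralArtin m →* Multiplicative ℤ :=
  PresentedGroup.toGroup (f := fun _ => Multiplicative.ofAdd (1 : ℤ)) (by
    intro r hr
    rw [dihedralRels, Set.mem_singleton_iff] at hr
    subst hr
    rw [map_mul, map_inv, mul_inv_eq_one, map_altWord, map_altWord, FreeGroup.lift_apply_of,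
      FreeGroup.lift_apply_of])

theorem dg_gen (m : ℕ) (b : Bool) : dg m (gen m b) = Multiplicative.ofAdd (1 : ℤ) :=
  PresentedGroup.toGroup.of _

theorem dg_F (m : ℕ) (b : Bool) (es : List ℤ) :
    dg m (F (gen m) b es) = Multiplicative.ofAdd es.sum := by
  rw [F_map]
  simp only [dg_gen]
  induction es generalizing b with
  | nil => simp [F]
  | cons e es ih => rw [F, ih, ← ofAdd_zsmul, ← ofAdd_add]; simp

theorem S_zpow (m : ℕ) (k : ℤ) : S m ^ k = 1 ∨ S m ^ k = S m := by
  rcases Int.even_or_odd' k with ⟨n, rfl | rfl⟩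
  · left; rw [zpow_mul, zpow_ofNat, pow_two, S_sq, one_zpow]
  · right; rw [zpow_add, zpow_mul, zpow_ofNat, pow_two, S_sq, one_zpow, one_mul, zpow_one]

theorem good_gen (m : ℕ) (hm : 3 ≤ m) : Good m (gen m) (Dl m) where
  h1 := Dl_eq m
  hn b := by
    have := F_rep_inv (gen m) m (fl (m + 1) b)
    rw [Dl_eq, fl_fl] at this
    exact (inv_eq_of_mul_eq_one_right this).symm
  nf b es k hne h0 h := by
    have := congrArg (phi m) h
    rw [F_map, map_zpow, ← Dl_eq m false, F_map] at this
    simp only [phi_gen] at this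
    have h2 : F (gi m) b es = S m ^ ((m : ℤ) * k) := by
      rw [zpow_mul, zpow_natCast, ← alt_gi_m m false, ← F_altWord]
      exact this
    refine nf_G m hm es b hne h0 ?_
    rw [h2]
    exact S_zpow m _
  deg b es k h := by
    have := congrArg (dg m) h
    rw [map_zpow, ← Dl_eq m false, dg_F, dg_F, ← ofAdd_zsmul] at this
    have := Multiplicative.ofAdd.injective this
    rw [this]
    simp [mul_comm]

/-- Alternating syllable list with prescribed exponents. -/
def al : Bool → List ℤ → List (Bool × ℤ)
  | _, [] => []
  | b, e :: es => (b, e) :: al (!b) es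

theorem al_append (b : Bool) (A B : List ℤ) : al b (A ++ B) = al b A ++ al (fl A.length b) B := by
  induction A generalizing b with
  | nil => simp [al, fl]
  | cons e A ih => simp [al, fl, ih]

theorem al_length (b : Bool) (A : List ℤ) : (al b A).length = A.length := by
  induction A generalizing b with
  | nil => simp [al]
  | cons e A ih => simp [al, ih]

theorem al_snd (b : Bool) (A : List ℤ) : (al b A).map Prod.snd = A := by
  induction A generalizing b with
  | nil => simp [al]
  | cons e A ih => simp [al, ih]

theorem al_swap (b : Bool) (A : List ℤ) : swapST (al b A) = al (!b) A := by
  induction A generalizing b with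
  | nil => simp [al, swapST]
  | cons e A ih =>
    have := ih (!b)
    simp only [swapST] at this ⊢
    simp [al, this]

theorem altList_eq (b : Bool) (e : ℤ) (n : ℕ) : altList b e n = al b (List.replicate n e) := by
  induction n generalizing b with
  | zero => simp [al, altList]
  | succ n ih => simp [al, altList, ih, List.replicate_succ]

theorem eval_al (m : ℕ) (b : Bool) (A : List ℤ) : evalSyllables m (al b A) = F (gen m) b A := by
  induction A generalizing b with
  | nil => simp [al, F, evalSyllables]
  | cons e A ih =>
    have := ih (!b)
    simp only [evalSyllables] at this ⊢
    simp [al, F, this]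

theorem canon_eq (m : ℕ) (hm : 3 ≤ m) (k : ℤ) : canonicalWord m k = al false (cn m k) := by
  rw [canonicalWord, cn, al, al_append, List.length_replicate, Bool.not_false, al, altList_eq]
  split_ifs with h
  · obtain ⟨n, rfl⟩ := h
    have h2 : fl (2 * n + 1 - 1) true = true := by rw [Nat.add_sub_cancel, fl_two]
    rw [h2, altList_eq]; rfl
  · rw [Nat.not_odd_iff_even] at h
    obtain ⟨n, rfl⟩ := h
    obtain ⟨k, rfl⟩ : ∃ k, n = k + 1 := ⟨n - 1, by omega⟩
    have h2 : fl (k + 1 + (k + 1) - 1) true = false := by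
      rw [show k + 1 + (k + 1) - 1 = 2 * k + 1 by omega, fl_succ, fl_two]; rfl
    rw [h2, altList_eq]; rfl

theorem syll_flat {m : ℕ} (i j : Fin m → ℤ) (l : List (Fin m)) :
    (l.flatMap fun p => [(false, i p), (true, j p)]) = al false (l.flatMap fun p => [i p, j p]) := by
  induction l with
  | nil => simp [al]
  | cons p l ih => simp [al, ih]

theorem al_rotate (b : Bool) (es : List ℤ) (n : ℕ) (hl : es.length = 2 * n) (d : ℕ) :
    ∃ c, (al b es).rotate d = al c (es.rotate d) ∧ (al (!b) es).rotate d = al (!c) (es.rotate d) := by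
  induction d generalizing b es with
  | zero => exact ⟨b, by simp⟩
  | succ d ih =>
    cases es with
    | nil => exact ⟨b, by simp [al]⟩
    | cons e es =>
      have hodd : fl es.length (!b) = b := by
        have : fl (es.length + 1) b = b := by
          rw [show es.length + 1 = 2 * n by simpa using hl, fl_two]
        exact this
      have hodd2 : fl es.length b = !b := by
        have : fl (es.length + 1) (!b) = !b := by
          rw [show es.length + 1 = 2 * n by simpa using hl, fl_two]
        rw [fl, Bool.not_not] at this
        exact this
      obtain ⟨c, h1, h2⟩ := ih (!b) (es ++ [e]) (by simpa using hl)
      refine ⟨c, ?_, ?_⟩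
      · rw [List.rotate_cons_succ, ← h1, al, List.rotate_cons_succ, al_append, hodd]
        rfl
      · rw [List.rotate_cons_succ, ← h2, al, List.rotate_cons_succ, al_append, Bool.not_not, hodd2]
        rfl

theorem main_list (m : ℕ) (hm : 3 ≤ m) (es : List ℤ) (hl : es.length = 2 * m)
    (h0 : ∀ x ∈ es, x ≠ 0) :
    evalSyllables m (al false es) = 1 ↔
      ∃ k : ℤ, k ≠ 0 ∧ ∃ d : ℕ,
        (al false es).rotate d = canonicalWord m k ∨
        (swapST (al false es)).rotate d = canonicalWord m k := by
  rw [eval_al, al_swap]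
  constructor
  · intro h
    obtain ⟨k, hk, d, hd⟩ := main_fwd (good_gen m hm) hm false es hl h0 h
    refine ⟨k, hk, d, ?_⟩
    obtain ⟨c, h1, h2⟩ := al_rotate false es m hl d
    rw [h1, h2, hd, canon_eq m hm]
    cases c
    · left; rfl
    · right; rfl
  · rintro ⟨k, hk, d, hd⟩
    have hrot : es.rotate d = cn m k := by
      rw [canon_eq m hm] at hd
      rcases hd with hd | hd
      all_goals
        have := congrArg (List.map Prod.snd) hd
        rwa [List.map_rotate, al_snd, al_snd] at this
    obtain ⟨d', hd', heq⟩ := (List.isRotated_iff_mod (l := es) (l' := cn m k)).1 ⟨d, hrot⟩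
    rw [List.rotate_eq_drop_append_take hd'] at heq
    rw [← List.take_append_drop d' es]
    rw [F_rot (gen m) false _ _ m (by rw [List.take_append_drop]; exact hl), heq]
    exact cn_trivial hm (Dl_eq m) _ k

end DihArt

/-- A word `s^{i₁} t^{j₁} ⋯ s^{iₘ} t^{jₘ}` with `2m` (nonempty) syllables is trivial
in the dihedral Artin group with exponent `m ≥ 3` if and only if, up to interchanging
`s` with `t` and up to a cyclic permutation of its syllables, it is the canonical word
`s^k (ts⋯ts) t^{-k} (s⁻¹t⁻¹⋯s⁻¹t⁻¹)` (`m` odd), resp.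
`s^k (ts⋯st) s^{-k} (t⁻¹s⁻¹⋯s⁻¹t⁻¹)` (`m` even), for some `k ≠ 0`. -/
theorem dihedral_word_trivial_iff (m : ℕ) (hm : 3 ≤ m) (i j : Fin m → ℤ)
    (hi : ∀ p, i p ≠ 0) (hj : ∀ p, j p ≠ 0) :
    evalSyllables m (syllableList m i j) = 1 ↔
      ∃ k : ℤ, k ≠ 0 ∧ ∃ d : ℕ,
        (syllableList m i j).rotate d = canonicalWord m k ∨
        (swapST (syllableList m i j)).rotate d = canonicalWord m k := by
  have h := DihArt.main_list m hm ((List.finRange m).flatMap fun p => [i p, j p])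
    (by simp [List.length_flatMap, mul_comm])
    (by
      intro x hx
      simp only [List.mem_flatMap, List.mem_cons, List.not_mem_nil, or_false] at hx
      obtain ⟨p, _, rfl | rfl⟩ := hx
      · exact hi p
      · exact hj p)
  rw [← DihArt.syll_flat i j] at h
  exact h
end

section
/- Let A_S be a two-dimensional Artin group and let s ≠ t in S satisfy m_{st} < ∞. Then the natural homomorphism from the dihedral Artin group A_{st} = ⟨s, t | prod(s,t;m_{st}) = prod(t,s;m_{st})⟩ to A_S sending generator to generator is injective. -/
open scoped ENNReal

/-- The Artin relations associated to a matrix of exponents `M : S → S → ℕ∞`: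
for each pair `s ≠ t` with `M s t = n < ∞`, the relation
`prod(s,t;n) = prod(t,s;n)`. -/
def artinRels {S : Type*} (M : S → S → ℕ∞) : Set (FreeGroup S) :=
  { w | ∃ s t : S, s ≠ t ∧ ∃ n : ℕ, M s t = (n : ℕ∞) ∧
      w = altWord (FreeGroup.of s) (FreeGroup.of t) n *
        (altWord (FreeGroup.of t) (FreeGroup.of s) n)⁻¹ }

/-- The Artin group with generating set `S` and exponents `M`. -/
abbrev ArtinGroup {S : Type*} (M : S → S → ℕ∞) := PresentedGroup (artinRels M)

/-- The Artin group is two-dimensional if `1/m_{st} + 1/m_{tr} + 1/m_{sr} ≤ 1` for all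
pairwise distinct `s, t, r ∈ S` (with the convention `1/∞ = 0`). -/
def TwoDimensional {S : Type*} (M : S → S → ℕ∞) : Prop :=
  ∀ s t r : S, s ≠ t → t ≠ r → s ≠ r →
    ((M s t : ℝ≥0∞))⁻¹ + ((M t r : ℝ≥0∞))⁻¹ + ((M s r : ℝ≥0∞))⁻¹ ≤ 1

namespace ArtinAux
open Polynomial Polynomial.Chebyshev

section Order
variable {B : Type*} (M : CoxeterMatrix B)

/-- The angle. -/
noncomputable def ang (a b : B) : ℝ := Real.pi / (M a b : ℝ)

/-- The coroot functional of the Tits representation. -/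
noncomputable def cor (a : B) : Module.Dual ℝ (B →₀ ℝ) :=
  Finsupp.linearCombination ℝ (fun b => -2 * Real.cos (ang M a b))

lemma cor_single (a b : B) : cor M a (Finsupp.single b 1) = -2 * Real.cos (ang M a b) := by
  simp [cor]

lemma cor_self (a : B) : cor M a (Finsupp.single a 1) = 2 := by
  simp [cor_single, ang]

/-- The reflections of the Tits representation. -/
noncomputable def refl (a : B) : (B →₀ ℝ) ≃ₗ[ℝ] (B →₀ ℝ) := Module.reflection (cor_self M a)

lemma ang_symm (a b : B) : ang M a b = ang M b a := by simp [ang, M.symmetric a b]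

lemma tval (a b : B) : cor M a (Finsupp.single b 1) * cor M b (Finsupp.single a 1) - 2 =
    2 * Real.cos (2 * ang M a b) := by
  rw [cor_single, cor_single, ang_symm M b a, Real.cos_two_mul]; ring

lemma sin_pos_of {m : ℕ} (hm : 3 ≤ m) : 0 < Real.sin (2 * (Real.pi / (m : ℝ))) := by
  have hm' : (3 : ℝ) ≤ m := by exact_mod_cast hm
  have := Real.pi_pos
  apply Real.sin_pos_of_pos_of_lt_pi
  · positivity
  · rw [mul_div_assoc', div_lt_iff₀ (by linarith)]; nlinarith

lemma refl_mul_pow (a b : B) : (refl M a * refl M b) ^ M a b = 1 := by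
  rcases Nat.lt_or_ge (M a b) 3 with hlt | hge
  · have : M a b = 0 ∨ M a b = 1 ∨ M a b = 2 := by omega
    rcases this with h | h | h
    · simp [h]
    · have hab : a = b := by by_contra hab; exact M.off_diagonal a b hab h
      subst hab
      rw [h, pow_one]
      ext1 z
      simp only [refl, LinearEquiv.mul_apply]
      exact Module.involutive_reflection (cor_self M a) z
    · have h1 : cor M a (Finsupp.single b 1) = 0 := by simp [cor_single, ang, h]
      have h2 : cor M b (Finsupp.single a 1) = 0 := by
        simp [cor_single, ang, h, M.symmetric b a]
      ext1 z
      rw [h, pow_two]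
      simp only [refl, LinearEquiv.mul_apply, Module.reflection_apply, map_sub, map_smul, h1, h2,
        cor_self, LinearEquiv.coe_one, id_eq]
      match_scalars <;> ring
  · ext1 z
    have hs := sin_pos_of hge
    set m := M a b with hm
    have hS : ∀ k : ℤ, (S ℝ k).eval (2 * Real.cos (2 * ang M a b)) * Real.sin (2 * ang M a b) =
      Real.sin ((k + 1) * (2 * ang M a b)) := fun k => S_two_mul_real_cos _ _
    have hθ : ang M a b = Real.pi / m := rfl
    rw [refl, refl, Module.reflection_mul_reflection_pow_apply (cor_self M a) (cor_self M b) m z _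
      (tval M a b).symm]
    have hm0 : (m : ℝ) ≠ 0 := by positivity
    have hsne := hs.ne'
    rcases Nat.even_or_odd' m with ⟨k, hk | hk⟩
    · have e1 : ((m : ℤ) - 2) / 2 = k - 1 := by omega
      have e2 : ((m : ℤ) - 1) / 2 = k - 1 := by omega
      have h0 : (S ℝ ((k : ℤ) - 1)).eval (2 * Real.cos (2 * ang M a b)) = 0 := by
        have := hS (k - 1)
        rw [show (((k - 1 : ℤ) : ℝ) + 1) * (2 * ang M a b) = Real.pi by
          have : (m : ℝ) = 2 * k := by exact_mod_cast hk
          rw [hθ]; field_simp; push_cast; rw [this]; ring, Real.sin_pi] at this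
        exact (mul_eq_zero.1 this).resolve_right hsne
      rw [e1, e2, h0]; simp
    · have e1 : ((m : ℤ) - 2) / 2 = k - 1 := by omega
      have e2 : ((m : ℤ) - 1) / 2 = k := by omega
      have e3 : ((m : ℤ) - 3) / 2 = k - 1 := by omega
      have e4 : (m : ℤ) / 2 = k := by omega
      have h0 : (S ℝ (k : ℤ)).eval (2 * Real.cos (2 * ang M a b)) +
          (S ℝ ((k : ℤ) - 1)).eval (2 * Real.cos (2 * ang M a b)) = 0 := by
        have h1 := hS (k - 1)
        have h2 := hS k
        have hmk : (m : ℝ) = 2 * k + 1 := by exact_mod_cast hk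
        rw [show (((k - 1 : ℤ) : ℝ) + 1) * (2 * ang M a b) = Real.pi - ang M a b by
          rw [hθ]; field_simp; push_cast; rw [hmk]; ring, Real.sin_pi_sub] at h1
        rw [show (((k : ℤ) : ℝ) + 1) * (2 * ang M a b) = ang M a b + Real.pi by
          rw [hθ]; field_simp; push_cast; rw [hmk]; ring, Real.sin_add_pi] at h2
        have := congrArg₂ (· + ·) h1 h2
        simp only [← add_mul, add_neg_cancel] at this
        rw [add_comm]
        exact (mul_eq_zero.1 this).resolve_right hsne
      rw [e1, e2, e3, e4, h0]; simp

lemma refl_pow_ne (a b : B) (hab : a ≠ b) (j : ℕ) (hj : 0 < j) (hjm : 2 * j ≤ M a b) :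
    (refl M a * refl M b) ^ j ≠ 1 := by
  intro h
  have h1 := Module.reflection_mul_reflection_pow_apply_self (cor_self M a) (cor_self M b) j _
      (tval M a b).symm
  rw [← refl, ← refl, h] at h1
  have ha := congrArg (fun v => v a) h1
  have hb := congrArg (fun v => v b) h1
  simp [hab, hab.symm] at ha hb
  have hθ : ang M a b = Real.pi / M a b := rfl
  rcases Nat.lt_or_ge (M a b) 3 with hlt | hge
  · have hj1 : j = 1 := by omega
    have hm2 : M a b = 2 := by omega
    subst hj1
    rw [hθ, hm2] at ha
    norm_num at ha
    rw [show 2 * (Real.pi / 2) = Real.pi by ring, Real.cos_pi] at ha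
    norm_num at ha
  · have hs := sin_pos_of hge
    have hS : ∀ k : ℤ, (S ℝ k).eval (2 * Real.cos (2 * ang M a b)) * Real.sin (2 * ang M a b) =
      Real.sin ((k + 1) * (2 * ang M a b)) := fun k => S_two_mul_real_cos _ _
    have hm3 : (3 : ℝ) ≤ M a b := by exact_mod_cast hge
    have hpi := Real.pi_pos
    have hc : cor M b (Finsupp.single a 1) ≠ 0 := by
      rw [cor_single, ang_symm, hθ]
      have : 0 < Real.cos (Real.pi / M a b) := by
        apply Real.cos_pos_of_mem_Ioo
        constructor
        · have : 0 < Real.pi / M a b := by positivity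
          linarith
        · rw [div_lt_div_iff₀ (by linarith) (by norm_num)]; nlinarith
      intro h0
      linarith
    have h0 := hb.resolve_right hc
    have h2 := hS (j - 1)
    have h3 := hS j
    rw [h0, zero_mul] at h2
    rw [h0, add_zero] at ha
    rw [← ha, one_mul] at h3
    have hjm' : (2 : ℝ) * j ≤ M a b := by exact_mod_cast hjm
    have hjp : (0 : ℝ) < j := by exact_mod_cast hj
    rcases hjm.lt_or_eq with hlt | heq
    · have hlt' : (2 : ℝ) * j < M a b := by exact_mod_cast hlt
      have : 0 < Real.sin ((((j - 1 : ℤ) : ℝ) + 1) * (2 * ang M a b)) := by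
        have e : (((j - 1 : ℤ) : ℝ) + 1) * (2 * ang M a b) = (2 * j) * Real.pi / M a b := by
          rw [hθ]; push_cast; ring
        rw [e]
        apply Real.sin_pos_of_pos_of_lt_pi
        · positivity
        · rw [div_lt_iff₀ (by linarith)]; nlinarith
      linarith
    · have heq' : (2 : ℝ) * j = M a b := by exact_mod_cast heq
      have hm0 : (M a b : ℝ) ≠ 0 := by linarith
      rw [show (((j : ℤ) : ℝ) + 1) * (2 * ang M a b) = 2 * ang M a b + Real.pi by
        rw [hθ]; field_simp; push_cast; rw [← heq']; ring, Real.sin_add_pi, hθ] at h3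
      linarith

lemma orderOf_simple_mul {W : Type*} [Group W] (cs : CoxeterSystem M W) (a b : B) (hab : a ≠ b)
    (h0 : M a b ≠ 0) : orderOf (cs.simple a * cs.simple b) = M a b := by
  have hdvd := orderOf_dvd_of_pow_eq_one (cs.simple_mul_simple_pow a b)
  by_contra hne
  obtain ⟨k, hk⟩ := hdvd
  set d := orderOf (cs.simple a * cs.simple b) with hd
  have hd0 : 0 < d := by
    rcases Nat.eq_zero_or_pos d with h | h
    · rw [h, zero_mul] at hk; exact absurd hk h0
    · exact h
  have hk2 : 2 ≤ k := by
    rcases k with _ | _ | k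
    · simp at hk; exact absurd hk h0
    · simp at hk; exact absurd hk.symm hne
    · omega
  apply refl_pow_ne M a b hab d hd0 (by rw [hk]; nlinarith)
  have h1 := pow_orderOf_eq_one (cs.simple a * cs.simple b)
  have hl : M.IsLiftable (refl M) := refl_mul_pow M
  have h2 := congrArg (cs.lift ⟨refl M, hl⟩) h1
  rw [map_pow, map_mul, cs.lift_apply_simple, cs.lift_apply_simple, map_one] at h2
  exact h2
end Order
end ArtinAux

namespace ArtinAux
open Classical
variable {B : Type*} {M : CoxeterMatrix B} {W : Type*} [Group W] (cs : CoxeterSystem M W)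

lemma conj_iff {G : Type*} [Group G] (u x y : G) : u * x * u⁻¹ = y ↔ x = u⁻¹ * y * u := by
  rw [mul_inv_eq_iff_eq_mul, mul_assoc, eq_inv_mul_iff_mul_eq]

/-- Indicator of equality with values in `ZMod 2`. -/
noncomputable def ind {α : Type*} (x y : α) : ZMod 2 := if x = y then 1 else 0

lemma ind_congr {α β : Type*} {x y : α} {z w : β} (h : x = y ↔ z = w) : ind x y = ind z w := by
  simp [ind, h]

lemma ind_conj_simple (c : B) (r : W) :
    ind (cs.simple c * r * (cs.simple c)⁻¹) (cs.simple c) = ind r (cs.simple c) :=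
  ind_congr (by rw [conj_iff]; simp)

/-- The signed conjugation by a simple reflection. -/
noncomputable def sgnPerm (c : B) : Equiv.Perm (W × ZMod 2) where
  toFun p := (cs.simple c * p.1 * (cs.simple c)⁻¹, p.2 + ind p.1 (cs.simple c))
  invFun p := (cs.simple c * p.1 * (cs.simple c)⁻¹, p.2 + ind p.1 (cs.simple c))
  left_inv p := by
    obtain ⟨r, e⟩ := p
    refine Prod.ext ?_ ?_
    · simp [mul_assoc]
    · simp only [ind_conj_simple, add_assoc, CharTwo.add_self_eq_zero, add_zero]
  right_inv p := by
    obtain ⟨r, e⟩ := p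
    refine Prod.ext ?_ ?_
    · simp [mul_assoc]
    · simp only [ind_conj_simple, add_assoc, CharTwo.add_self_eq_zero, add_zero]

lemma sgnPerm_apply (c : B) (r : W) (e : ZMod 2) :
    sgnPerm cs c (r, e) = (cs.simple c * r * (cs.simple c)⁻¹, e + ind r (cs.simple c)) := rfl

lemma simple_conj_pow (a b : B) (k : ℕ) :
    cs.simple b * (cs.simple a * cs.simple b) ^ k =
      ((cs.simple a * cs.simple b)⁻¹) ^ k * cs.simple b := by
  induction k with
  | zero => simp
  | succ k ih =>
    rw [pow_succ, ← mul_assoc, ih, pow_succ]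
    simp [mul_assoc]

lemma sgnPerm_pow (a b : B) (k : ℕ) (r : W) (e : ZMod 2) :
    ((sgnPerm cs a * sgnPerm cs b) ^ k) (r, e) =
      ((cs.simple a * cs.simple b) ^ k * r * ((cs.simple a * cs.simple b) ^ k)⁻¹,
        e + ∑ j ∈ Finset.range (2 * k),
          ind r (((cs.simple a * cs.simple b)⁻¹) ^ j * cs.simple b)) := by
  induction k with
  | zero => simp
  | succ k ih =>
    rw [pow_succ', Equiv.Perm.mul_apply, ih, Equiv.Perm.mul_apply]
    set c := cs.simple a * cs.simple b with hc
    have hcb := simple_conj_pow cs a b k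
    rw [← hc] at hcb
    have h1 : c ^ k * r * (c ^ k)⁻¹ = cs.simple b ↔ r = c⁻¹ ^ (2 * k) * cs.simple b := by
      rw [conj_iff, mul_assoc, hcb, two_mul, pow_add, inv_pow, mul_assoc]
    have h2 : cs.simple b * (c ^ k * r * (c ^ k)⁻¹) * (cs.simple b)⁻¹ = cs.simple a ↔
        r = c⁻¹ ^ (2 * k + 1) * cs.simple b := by
      have e2 : cs.simple b * cs.simple a = c⁻¹ := by simp [hc]
      rw [conj_iff, conj_iff, cs.inv_simple, e2, mul_assoc, mul_assoc, hcb, ← inv_pow]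
      simp only [← mul_assoc, ← pow_succ, ← pow_add]
      rw [show k + 1 + k = 2 * k + 1 by ring]
    rw [show 2 * (k + 1) = 2 * k + 1 + 1 by ring, Finset.sum_range_succ, Finset.sum_range_succ,
      sgnPerm_apply, sgnPerm_apply, ind_congr h1, ind_congr h2]
    refine Prod.ext ?_ ?_
    · simp only [pow_succ', hc, mul_inv_rev, mul_assoc]
    · simp only [add_assoc]

lemma sgnPerm_liftable : M.IsLiftable (sgnPerm cs) := by
  intro a b
  ext ⟨r, e⟩ : 1
  rw [sgnPerm_pow, cs.simple_mul_simple_pow]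
  have h : ∑ j ∈ Finset.range (2 * M a b),
      ind r (((cs.simple a * cs.simple b)⁻¹) ^ j * cs.simple b) = 0 := by
    rw [two_mul, Finset.sum_range_add]
    simp only [pow_add, inv_pow _ (M a b), cs.simple_mul_simple_pow, inv_one, one_mul]
    exact CharTwo.add_self_eq_zero _
  rw [h]
  simp

/-- The homomorphism to signed permutations. -/
noncomputable def sgnHom : W →* Equiv.Perm (W × ZMod 2) := cs.lift ⟨_, sgnPerm_liftable cs⟩

/-- The inversion cocycle. -/
noncomputable def N (w r : W) : ZMod 2 := (sgnHom cs w (r, 0)).2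

lemma sgnHom_simple (c : B) : sgnHom cs (cs.simple c) = sgnPerm cs c :=
  cs.lift_apply_simple (sgnPerm_liftable cs) c

lemma sgnHom_apply (w : W) : ∀ (r : W) (e : ZMod 2),
    sgnHom cs w (r, e) = (w * r * w⁻¹, e + N cs w r) := by
  induction w using cs.simple_induction_left with
  | one => intro r e; simp [N]
  | mul_simple_left w c ih =>
    intro r e
    have key : ∀ e, sgnHom cs (cs.simple c * w) (r, e) =
      (cs.simple c * w * r * (cs.simple c * w)⁻¹,
        e + (N cs w r + ind (w * r * w⁻¹) (cs.simple c))) := by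
      intro e
      rw [map_mul, Equiv.Perm.mul_apply, ih, sgnHom_simple, sgnPerm_apply]
      simp only [mul_assoc, mul_inv_rev, add_assoc]
    rw [N, key, key, zero_add]

lemma N_one (r : W) : N cs 1 r = 0 := by simp [N]

lemma N_mul (u v r : W) : N cs (u * v) r = N cs v r + N cs u (v * r * v⁻¹) := by
  have := sgnHom_apply cs (u * v) r 0
  rw [map_mul, Equiv.Perm.mul_apply, sgnHom_apply, sgnHom_apply] at this
  simpa using (congrArg Prod.snd this).symm

lemma N_simple (c : B) (r : W) : N cs (cs.simple c) r = ind r (cs.simple c) := by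
  simp [N, sgnHom_simple, sgnPerm_apply]

lemma N_simple_mul (c : B) (w r : W) :
    N cs (cs.simple c * w) r = N cs w r + ind (w * r * w⁻¹) (cs.simple c) := by
  rw [N_mul, N_simple]

/-- Deletion. -/
lemma deletion (ω : List B) (r : W) (h : N cs (cs.wordProd ω) r ≠ 0) :
    ∃ ω' : List B, ω'.length < ω.length ∧ (∀ x ∈ ω', x ∈ ω) ∧
      cs.wordProd ω * r = cs.wordProd ω' := by
  induction ω with
  | nil => simp [N_one] at h
  | cons a ω ih =>
    rw [cs.wordProd_cons, N_simple_mul] at h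
    by_cases h1 : N cs (cs.wordProd ω) r = 0
    · rw [h1, zero_add, ind] at h
      have h2 : cs.wordProd ω * r * (cs.wordProd ω)⁻¹ = cs.simple a := by
        by_contra h3; simp [h3] at h
      refine ⟨ω, by simp, by simp +contextual, ?_⟩
      rw [mul_inv_eq_iff_eq_mul] at h2
      rw [cs.wordProd_cons, mul_assoc, h2]; simp
    · obtain ⟨ω', hl, hs, he⟩ := ih h1
      refine ⟨a :: ω', by simpa using hl, ?_, ?_⟩
      · intro x hx
        rcases List.mem_cons.1 hx with rfl | hx
        · simp
        · exact List.mem_cons_of_mem _ (hs x hx)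
      · rw [cs.wordProd_cons, cs.wordProd_cons, mul_assoc, he]

/-- Standard parabolic subgroup. -/
def para (T : Set B) : Subgroup W := Subgroup.closure (cs.simple '' T)

lemma simple_mem_para {T : Set B} {c : B} (h : c ∈ T) : cs.simple c ∈ para cs T :=
  Subgroup.subset_closure ⟨c, h, rfl⟩

lemma para_word {T : Set B} {w : W} (h : w ∈ para cs T) :
    ∃ ω : List B, (∀ x ∈ ω, x ∈ T) ∧ cs.wordProd ω = w := by
  induction h using Subgroup.closure_induction with
  | mem x hx => obtain ⟨c, hc, rfl⟩ := hx; exact ⟨[c], by simpa using hc, by simp⟩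
  | one => exact ⟨[], by simp, by simp⟩
  | mul x y _ _ hx hy =>
    obtain ⟨ω, h1, rfl⟩ := hx
    obtain ⟨ω', h2, rfl⟩ := hy
    refine ⟨ω ++ ω', ?_, by rw [cs.wordProd_append]⟩
    intro x hx
    rcases List.mem_append.1 hx with h | h
    exacts [h1 x h, h2 x h]
  | inv x _ hx =>
    obtain ⟨ω, h1, rfl⟩ := hx
    exact ⟨ω.reverse, by simpa using h1, by simp⟩

lemma N_para_support {T : Set B} {w : W} (h : w ∈ para cs T) :
    ∀ r, N cs w r ≠ 0 → r ∈ para cs T := by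
  induction h using Subgroup.closure_induction with
  | mem x hx =>
    obtain ⟨c, hc, rfl⟩ := hx
    intro r hr
    rw [N_simple, ind] at hr
    have : r = cs.simple c := by by_contra h; simp [h] at hr
    rw [this]; exact simple_mem_para cs hc
  | one => intro r hr; simp [N_one] at hr
  | mul x y hx0 hy0 hx hy =>
    intro r hr
    by_contra hn
    apply hr
    rw [N_mul]
    have h1 : N cs y r = 0 := by by_contra h; exact hn (hy r h)
    have h2 : N cs x (y * r * y⁻¹) = 0 := by
      by_contra h
      have := hx _ h
      apply hn
      have h3 := mul_mem (mul_mem (inv_mem hy0) this) hy0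
      simpa [mul_assoc, para] using h3
    rw [h1, h2, add_zero]
  | inv x hx0 hx =>
    intro r hr
    have h0 := N_mul cs x x⁻¹ r
    rw [mul_inv_cancel, N_one] at h0
    by_contra hn
    have h1 : N cs x (x⁻¹ * r * x⁻¹⁻¹) = 0 := by
      by_contra h
      have := hx _ h
      apply hn
      have h3 := mul_mem (mul_mem hx0 this) (inv_mem hx0)
      simpa [mul_assoc, para] using h3
    rw [h1, add_zero] at h0
    exact hr h0.symm

lemma exists_descent {T : Set B} {w : W} (h : w ∈ para cs T) (hw : w ≠ 1) :
    ∃ p ∈ T, N cs w (cs.simple p) ≠ 0 := by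
  have hex : ∃ n : ℕ, ∃ ω : List B, (∀ x ∈ ω, x ∈ T) ∧ cs.wordProd ω = w ∧ ω.length = n := by
    obtain ⟨ω, h1, h2⟩ := para_word cs h
    exact ⟨_, ω, h1, h2, rfl⟩
  obtain ⟨ω, h1, h2, h3⟩ := Nat.find_spec hex
  rcases List.eq_nil_or_concat ω with rfl | ⟨ω1, p, rfl⟩
  · simp at h2; exact absurd h2.symm hw
  have hw' : w = cs.wordProd ω1 * cs.simple p := by
    rw [← h2]; simp [cs.wordProd_append]
  refine ⟨p, h1 p (by simp), ?_⟩
  rw [hw', N_mul, N_simple]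
  by_cases hN : N cs (cs.wordProd ω1) (cs.simple p) = 0
  · simp [hN, ind]
  · exfalso
    obtain ⟨ω', hl, hs, he⟩ := deletion cs ω1 _ hN
    refine Nat.find_min hex (m := ω'.length) ?_ ⟨ω', ?_, ?_, rfl⟩
    · rw [← h3]; simp; omega
    · intro x hx; exact h1 x (by simp [hs x hx])
    · rw [hw', he]

/-- The minimal representatives. -/
def IsMin (T : Set B) (y : W) : Prop := ∀ r ∈ para cs T, N cs y r = 0

lemma isMin_simple_mul {T : Set B} {y : W} (hy : IsMin cs T y) {c : B}
    (hc : y⁻¹ * cs.simple c * y ∉ para cs T) : IsMin cs T (cs.simple c * y) := by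
  intro r hr
  rw [N_simple_mul, hy r hr, zero_add, ind, if_neg]
  rw [conj_iff]
  rintro rfl
  exact hc hr

lemma simple_ne_one (c : B) : cs.simple c ≠ 1 := by
  intro h
  have := cs.length_simple c
  rw [h, cs.length_one] at this
  omega

lemma stay_simple {T : Set B} {y : W} (hy : IsMin cs T y) {c : B}
    (hc : y⁻¹ * cs.simple c * y ∈ para cs T) : ∃ p ∈ T, y⁻¹ * cs.simple c * y = cs.simple p := by
  set r := y⁻¹ * cs.simple c * y with hr
  have hr1 : r ≠ 1 := by
    intro h
    have : cs.simple c = 1 := by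
      have := congrArg (fun z => y * z * y⁻¹) (hr.symm.trans h)
      simpa [mul_assoc] using this
    exact simple_ne_one cs c this
  obtain ⟨p, hp, hN⟩ := exists_descent cs hc hr1
  refine ⟨p, hp, ?_⟩
  have h1 := N_mul cs y r (cs.simple p)
  have hpm := simple_mem_para cs hp
  rw [hy _ (mul_mem (mul_mem hc hpm) (inv_mem hc)), add_zero] at h1
  rw [show y * r = cs.simple c * y by simp [hr, mul_assoc], N_simple_mul, hy _ hpm, zero_add] at h1
  rw [← h1, ind] at hN
  have h2 : y * cs.simple p * y⁻¹ = cs.simple c := by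
    by_contra h; simp [h] at hN
  rw [conj_iff] at h2
  rw [hr, h2]

/-- Right-minimal element in the coset. -/
lemma exists_coset_min (U : Set B) (y : W) :
    ∃ y0 : W, ∃ x ∈ para cs U, y = x * y0 ∧ ∀ z ∈ para cs U, N cs y0 (y0⁻¹ * z * y0) = 0 := by
  have hex : ∃ n : ℕ, ∃ ω : List B, (∃ x ∈ para cs U, y = x * cs.wordProd ω) ∧ ω.length = n := by
    obtain ⟨ω, rfl⟩ := cs.wordProd_surjective y
    exact ⟨_, ω, ⟨1, one_mem _, by simp⟩, rfl⟩
  obtain ⟨ω, ⟨x, hx, h2⟩, h3⟩ := Nat.find_spec hex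
  refine ⟨cs.wordProd ω, x, hx, h2, ?_⟩
  intro z hz
  by_contra hN
  obtain ⟨ω', hl, hs, he⟩ := deletion cs ω _ hN
  refine Nat.find_min hex (m := ω'.length) ?_ ⟨ω', ⟨x * z⁻¹, mul_mem hx (inv_mem hz), ?_⟩, rfl⟩
  · rw [← h3]; exact hl
  · rw [← he, h2]; simp [mul_assoc]

/-- The coset decomposition: for a minimal `y`, either at most one simple reflection occurs in
the intersection, or `y` is fixed by all of `U`. -/
lemma kilmoyer {T U : Set B} {y : W} (hy : IsMin cs T y) (a b : B) (hU : U = {a, b})  :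
    (∃ p : W, p * p = 1 ∧ ∀ c ∈ U, ∀ x ∈ para cs U,
        y⁻¹ * (x⁻¹ * cs.simple c * x) * y ∈ para cs T → 
        y⁻¹ * (x⁻¹ * cs.simple c * x) * y = p) ∨
    (∀ c ∈ U, y⁻¹ * cs.simple c * y ∈ para cs T) := by
  obtain ⟨y0, x, hx, rfl, hmin⟩ := exists_coset_min cs U y
  -- `y0` is also minimal for `T`
  have hy0 : IsMin cs T y0 := by
    intro r hr
    by_contra hN
    have h1 := hy r hr
    rw [N_mul] at h1
    have h2 : N cs x (y0 * r * y0⁻¹) ≠ 0 := by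
      intro h; rw [h, add_zero] at h1; exact hN h1
    have h3 := hmin _ (N_para_support cs hx _ h2)
    simp [mul_assoc] at h3
    exact hN h3
  -- support comparison
  have hD1 : ∀ u ∈ para cs T, u ≠ 1 → y0 * u * y0⁻¹ ∈ para cs U →
      ∃ p ∈ T, N cs u (cs.simple p) ≠ 0 ∧ ∃ c ∈ U, cs.simple p = y0⁻¹ * cs.simple c * y0 := by
    have key : ∀ u ∈ para cs T, ∀ z, N cs u z + N cs y0 (u * z * u⁻¹) =
        N cs y0 z + N cs (y0 * u * y0⁻¹) (y0 * z * y0⁻¹) := by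
      intro u hu z
      rw [← N_mul, ← N_mul]
      simp [mul_assoc]
    intro u hu hu1 huU
    obtain ⟨p, hp, hN⟩ := exists_descent cs hu hu1
    refine ⟨p, hp, hN, ?_⟩
    have hpm := simple_mem_para cs hp
    have h1 := key u hu (cs.simple p)
    rw [hy0 _ hpm, hy0 _ (mul_mem (mul_mem hu hpm) (inv_mem hu)), add_zero, zero_add] at h1
    rw [h1] at hN
    have hpU := N_para_support cs huU _ hN
    have hne : y0 * cs.simple p * y0⁻¹ ≠ 1 := by
      rw [Ne, conj_iff]; simpa using simple_ne_one cs p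
    obtain ⟨c, hc, hNc⟩ := exists_descent cs hpU hne
    refine ⟨c, hc, ?_⟩
    have h2 := key _ hpm (y0⁻¹ * cs.simple c * y0)
    have e1 := hmin _ (simple_mem_para cs hc)
    have e2 := hmin _ (mul_mem (mul_mem hpU (simple_mem_para cs hc)) (inv_mem hpU))
    rw [e1, show cs.simple p * (y0⁻¹ * cs.simple c * y0) * (cs.simple p)⁻¹ =
      y0⁻¹ * (y0 * cs.simple p * y0⁻¹ * cs.simple c * (y0 * cs.simple p * y0⁻¹)⁻¹) * y0 by
        simp [mul_assoc], e2, add_zero, zero_add] at h2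
    rw [show y0 * (y0⁻¹ * cs.simple c * y0) * y0⁻¹ = cs.simple c by simp [mul_assoc]] at h2
    rw [← h2, N_simple, ind] at hNc
    by_contra h
    exact hNc (if_neg (fun h' => h h'.symm))
  by_cases hall : ∀ c ∈ U, y0⁻¹ * cs.simple c * y0 ∈ para cs T
  · right
    have hx1 : x = 1 := by
      by_contra hx1
      obtain ⟨c, hc, hN⟩ := exists_descent cs hx hx1
      have h1 := hy _ (hall c hc)
      rw [N_mul, hy0 _ (hall c hc), zero_add] at h1
      simp [mul_assoc] at h1
      exact hN h1
    rw [hx1, one_mul]; exact hall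
  · left
    push Not at hall
    obtain ⟨d, hd, hdn⟩ := hall
    -- the other element
    obtain ⟨e, he, hde⟩ : ∃ e ∈ U, ∀ c ∈ U, c ≠ d → c = e := by
      subst hU
      rcases hd with rfl | hd
      · exact ⟨b, by simp, by rintro c (rfl | h) hcd; exacts [absurd rfl hcd, h]⟩
      · rw [Set.mem_singleton_iff] at hd
        subst hd
        exact ⟨a, by simp, by rintro c (h | h) hcd; exacts [h, absurd h hcd]⟩
    set p := y0⁻¹ * cs.simple e * y0 with hp
    have hpp : p * p = 1 := by simp [hp, mul_assoc]
    have hdesc : ∀ u ∈ para cs T, u ≠ 1 → y0 * u * y0⁻¹ ∈ para cs U →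
        N cs u p ≠ 0 ∧ p ∈ para cs T ∧ ∃ q, p = cs.simple q := by
      intro u hu hu1 huU
      obtain ⟨q, hq, hN, c, hc, hqc⟩ := hD1 u hu hu1 huU
      have hce : c = e := by
        apply hde c hc
        rintro rfl
        apply hdn
        rw [← hqc]; exact simple_mem_para cs hq
      subst hce
      rw [hp, ← hqc]
      exact ⟨hN, simple_mem_para cs hq, q, rfl⟩
    refine ⟨p, hpp, ?_⟩
    intro c hc x' hx' hmem
    set u := (x * y0)⁻¹ * (x'⁻¹ * cs.simple c * x') * (x * y0) with hu
    have hu1 : u ≠ 1 := by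
      intro h
      apply simple_ne_one cs c
      have h2 := congrArg (fun z => x' * (x * y0) * z * (x' * (x * y0))⁻¹) (hu.symm.trans h)
      simpa [mul_assoc] using h2
    have huU : y0 * u * y0⁻¹ ∈ para cs U := by
      have : y0 * u * y0⁻¹ = x⁻¹ * (x'⁻¹ * cs.simple c * x') * x := by
        simp [hu, mul_assoc]
      rw [this]
      exact mul_mem (mul_mem (inv_mem hx) (mul_mem (mul_mem (inv_mem hx')
        (simple_mem_para cs hc)) hx')) hx
    obtain ⟨hN, hpT, q, hq⟩ := hdesc u hmem hu1 huU
    by_contra hup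
    have h1 : u * p ≠ 1 := by
      intro h
      apply hup
      rw [mul_eq_one_iff_eq_inv] at h
      rw [h, inv_eq_of_mul_eq_one_left hpp]
    have h2 : y0 * (u * p) * y0⁻¹ ∈ para cs U := by
      have : y0 * (u * p) * y0⁻¹ = (y0 * u * y0⁻¹) * cs.simple e := by simp [hp, mul_assoc]
      rw [this]
      exact mul_mem huU (simple_mem_para cs he)
    obtain ⟨hN2, -, -⟩ := hdesc (u * p) (mul_mem hmem hpT) h1 h2
    apply hN2
    rw [N_mul, show p * p * p⁻¹ = p by simp]
    conv_lhs => lhs; rw [hq, N_simple]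
    simp only [ind, if_true]
    revert hN
    generalize N cs u p = z
    revert z
    decide
end ArtinAux
namespace ArtinAux
section Action
open Classical
variable {B : Type*} {M : CoxeterMatrix B} {W : Type*} [Group W] (cs : CoxeterSystem M W)

lemma altWord_succ_right {G : Type*} [Monoid G] (a b : G) (m : ℕ) :
    altWord a b (m + 1) = altWord a b m * (if Even m then a else b) := by
  induction m generalizing a b with
  | zero => simp [altWord]
  | succ m ih =>
    rw [altWord, ih b a, ← mul_assoc, show a * altWord b a m = altWord a b (m + 1) from rfl]
    by_cases h : Even m <;> simp [h, Nat.even_add_one]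

lemma altWord_conj {G : Type*} [Group G] (a b : G) (ha : a⁻¹ = a) (hb : b⁻¹ = b) (m : ℕ) :
    (altWord b a m)⁻¹ * a * altWord b a m =
      if Even m then (a * b) ^ m * a else (b * a) ^ m * b := by
  induction m with
  | zero => simp [altWord]
  | succ m ih =>
    rw [altWord_succ_right, mul_inv_rev]
    rw [show ∀ e : G, e⁻¹ * (altWord b a m)⁻¹ * a * (altWord b a m * e) =
      e⁻¹ * ((altWord b a m)⁻¹ * a * altWord b a m) * e by intro e; simp only [mul_assoc], ih]
    by_cases h : Even m
    · simp only [h, if_true, Nat.even_add_one, not_true, if_false, hb]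
      have : b * (a * b) ^ m = (b * a) ^ m * b := by
        have := SemiconjBy.pow_right (show SemiconjBy b (a * b) (b * a) by
          simp [SemiconjBy, mul_assoc]) m
        exact this
      rw [pow_succ, ← mul_assoc, this]; simp only [mul_assoc]
    · simp only [h, if_false, Nat.even_add_one, not_false_iff, if_true, ha]
      have : a * (b * a) ^ m = (a * b) ^ m * a := by
        have := SemiconjBy.pow_right (show SemiconjBy a (b * a) (a * b) by
          simp [SemiconjBy, mul_assoc]) m
        exact this
      rw [pow_succ, ← mul_assoc, this]; simp only [mul_assoc]

/-- Number of stays along an alternating word. -/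
noncomputable def cnt {G : Type*} [Group G] (P : G → Prop) : G → G → ℕ → ℕ
  | _, _, 0 => 0
  | a, b, m + 1 => cnt P b a m + if P ((altWord b a m)⁻¹ * a * altWord b a m) then 1 else 0

lemma cnt_eq {G : Type*} [Group G] (P : G → Prop) (a b : G) (ha : a⁻¹ = a) (hb : b⁻¹ = b) (m : ℕ) :
    cnt P a b m = if Even m then ∑ i ∈ Finset.range m, (if P ((b * a) ^ i * b) then 1 else 0)
      else ∑ i ∈ Finset.range m, (if P ((a * b) ^ i * a) then 1 else 0) := by
  induction m generalizing a b with
  | zero => simp [cnt]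
  | succ m ih =>
    rw [cnt, ih b a hb ha, altWord_conj a b ha hb, Finset.sum_range_succ, Finset.sum_range_succ]
    by_cases h : Even m <;> simp [h, Nat.even_add_one]

lemma sum_symm {G : Type*} [Group G] (P : G → Prop) (a b : G) (ha : a⁻¹ = a) (hb : b⁻¹ = b) (m : ℕ)
    (h : (a * b) ^ m = 1) :
    ∑ i ∈ Finset.range m, (if P ((b * a) ^ i * b) then 1 else 0) =
      ∑ i ∈ Finset.range m, (if P ((a * b) ^ i * a) then 1 else 0) := by
  rw [← Finset.sum_range_reflect]
  apply Finset.sum_congr rfl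
  intro i hi
  have hi' := Finset.mem_range.1 hi
  have : (b * a) ^ (m - 1 - i) * b = (a * b) ^ i * a := by
    have e : b * a = (a * b)⁻¹ := by rw [mul_inv_rev, ha, hb]
    have e2 : b = (a * b)⁻¹ * a := by
      rw [mul_inv_rev, mul_assoc, inv_mul_cancel, mul_one, hb]
    conv_lhs => rhs; rw [e2]
    rw [e, ← mul_assoc, ← pow_succ, inv_pow, mul_left_inj, inv_eq_iff_mul_eq_one, ← pow_add,
      show m - 1 - i + 1 + i = m by omega, h]
  rw [this]

lemma cnt_symm {G : Type*} [Group G] (P : G → Prop) (a b : G) (ha : a⁻¹ = a) (hb : b⁻¹ = b) (m : ℕ)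
    (h : (a * b) ^ m = 1) : cnt P a b m = cnt P b a m := by
  rw [cnt_eq P a b ha hb, cnt_eq P b a hb ha, sum_symm P a b ha hb m h]

lemma altWord_mem {G : Type*} [Group G] (H : Subgroup G) (a b : G) (ha : a ∈ H) (hb : b ∈ H)
    (m : ℕ) : altWord a b m ∈ H := by
  induction m generalizing a b with
  | zero => exact one_mem _
  | succ m ih => exact mul_mem ha (ih b a hb ha)

lemma altWord_map {G H : Type*} [Monoid G] [Monoid H] (f : G →* H) (a b : G) (m : ℕ) :
    f (altWord a b m) = altWord (f a) (f b) m := by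
  induction m generalizing a b with
  | zero => simp [altWord]
  | succ m ih => simp [altWord, ih]

lemma altWord_eq_of_pow {G : Type*} [Group G] (a b : G) (ha : a⁻¹ = a) (hb : b⁻¹ = b) (m : ℕ)
    (h : (a * b) ^ m = 1) : altWord a b m = altWord b a m := by
  have key : ∀ (a b : G), b⁻¹ = b → a⁻¹ = a → ∀ m, (altWord b a m)⁻¹ * altWord a b m =
      if Even m then (a * b) ^ m else (b * a) ^ m := by
    intro a b hb ha m
    induction m generalizing a b with
    | zero => simp [altWord]
    | succ m ih =>
      have h1 := altWord_conj a b ha hb m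
      have h2 := ih b a ha hb
      have h3 : altWord b a (m + 1) = altWord b a m * (if Even m then b else a) :=
        altWord_succ_right _ _ _
      rw [h3, altWord, mul_inv_rev]
      rw [show ∀ e : G, e⁻¹ * (altWord b a m)⁻¹ * (a * altWord b a m) =
        e⁻¹ * ((altWord b a m)⁻¹ * a * altWord b a m) by intro e; simp only [mul_assoc], h1]
      by_cases h : Even m
      · have : b * (a * b) ^ m = (b * a) ^ m * b := SemiconjBy.pow_right (show SemiconjBy b (a * b) (b * a) by
          simp [SemiconjBy, mul_assoc]) m
        simp only [h, if_true, Nat.even_add_one, not_true, if_false, hb]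
        rw [pow_succ, ← mul_assoc, this, mul_assoc]
      · have : a * (b * a) ^ m = (a * b) ^ m * a := SemiconjBy.pow_right (show SemiconjBy a (b * a) (a * b) by
          simp [SemiconjBy, mul_assoc]) m
        simp only [h, if_false, Nat.even_add_one, not_false_iff, if_true, ha]
        rw [pow_succ, ← mul_assoc, this, mul_assoc]
  have h2 : (b * a) ^ m = 1 := by
    rw [show b * a = (a * b)⁻¹ by rw [mul_inv_rev, ha, hb], inv_pow, h, inv_one]
  have := key a b hb ha m
  rw [h, h2, ite_self, inv_mul_eq_one] at this
  exact this.symm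

variable (T : Set B) {A : Type*} [Group A] (lab : W → A)

/-- The state space. -/
abbrev St (A : Type*) := {y : W // IsMin cs T y} × A

/-- One step of the action with a given labelling. -/
noncomputable def stepFun (lab : W → A) (c : B) (x : St cs T A) : St cs T A :=
  if h : x.1.1⁻¹ * cs.simple c * x.1.1 ∈ para cs T then
    (x.1, lab (x.1.1⁻¹ * cs.simple c * x.1.1) * x.2)
  else (⟨cs.simple c * x.1.1, isMin_simple_mul cs x.1.2 h⟩, x.2)

lemma stepFun_stepFun (l1 l2 : W → A) (h12 : ∀ w, l1 w * l2 w = 1) (c : B) (x : St cs T A) :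
    stepFun cs T l1 c (stepFun cs T l2 c x) = x := by
  by_cases h : x.1.1⁻¹ * cs.simple c * x.1.1 ∈ para cs T
  · have : stepFun cs T l2 c x = (x.1, l2 (x.1.1⁻¹ * cs.simple c * x.1.1) * x.2) := dif_pos h
    rw [this, stepFun, dif_pos h, ← mul_assoc, h12, one_mul]
  · have h2 : stepFun cs T l2 c x = (⟨cs.simple c * x.1.1, isMin_simple_mul cs x.1.2 h⟩, x.2) :=
      dif_neg h
    rw [h2, stepFun, dif_neg]
    · refine Prod.ext (Subtype.ext ?_) rfl
      simp
    · simpa [mul_assoc] using h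

/-- The permutation. -/
noncomputable def stepPerm (c : B) : Equiv.Perm (St cs T A) where
  toFun := stepFun cs T lab c
  invFun := stepFun cs T (fun w => (lab w)⁻¹) c
  left_inv := stepFun_stepFun cs T _ _ (by simp) c
  right_inv := stepFun_stepFun cs T _ _ (by simp) c

lemma stepPerm_pos (c : B) (x : St cs T A) (h : x.1.1⁻¹ * cs.simple c * x.1.1 ∈ para cs T) :
    stepPerm cs T lab c x = (x.1, lab (x.1.1⁻¹ * cs.simple c * x.1.1) * x.2) := dif_pos h

lemma stepPerm_neg (c : B) (x : St cs T A) (h : x.1.1⁻¹ * cs.simple c * x.1.1 ∉ para cs T) :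
    stepPerm cs T lab c x = (⟨cs.simple c * x.1.1, isMin_simple_mul cs x.1.2 h⟩, x.2) := dif_neg h

lemma walk_single (a b : B) (x : St cs T A) (p : W) (hp : p * p = 1)
    (hstay : ∀ c ∈ ({a, b} : Set B), ∀ u ∈ para cs {a, b},
        x.1.1⁻¹ * (u⁻¹ * cs.simple c * u) * x.1.1 ∈ para cs T →
        x.1.1⁻¹ * (u⁻¹ * cs.simple c * u) * x.1.1 = p)
    (hpT : p ∈ para cs T) (m : ℕ) :
    (altWord (stepPerm cs T lab a) (stepPerm cs T lab b) m x).1.1 =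
      altWord (cs.simple a) (cs.simple b) m * x.1.1 *
        p ^ cnt (fun r => x.1.1⁻¹ * r * x.1.1 = p) (cs.simple a) (cs.simple b) m ∧
    (altWord (stepPerm cs T lab a) (stepPerm cs T lab b) m x).2 =
      lab p ^ cnt (fun r => x.1.1⁻¹ * r * x.1.1 = p) (cs.simple a) (cs.simple b) m * x.2 := by
  induction m generalizing a b with
  | zero => simp [altWord, cnt]
  | succ m ih =>
    obtain ⟨h1, h2⟩ := ih b a (by rwa [Set.pair_comm])
    rw [altWord, Equiv.Perm.mul_apply, cnt]
    set x' := altWord (stepPerm cs T lab b) (stepPerm cs T lab a) m x with hx'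
    set k := cnt (fun r => x.1.1⁻¹ * r * x.1.1 = p) (cs.simple b) (cs.simple a) m with hk
    set u := altWord (cs.simple b) (cs.simple a) m with hu
    have huU : u ∈ para cs {a, b} :=
      altWord_mem _ _ _ (simple_mem_para cs (by simp)) (simple_mem_para cs (by simp)) m
    have hs := hstay a (by simp) u huU
    have hconj : x'.1.1⁻¹ * cs.simple a * x'.1.1 =
        (p ^ k)⁻¹ * (x.1.1⁻¹ * (u⁻¹ * cs.simple a * u) * x.1.1) * p ^ k := by
      rw [h1]; simp [mul_assoc]
    by_cases hc : x.1.1⁻¹ * (u⁻¹ * cs.simple a * u) * x.1.1 = p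
    · have e : x'.1.1⁻¹ * cs.simple a * x'.1.1 = p := by
        rw [hconj, hc, mul_assoc, ← pow_succ', pow_succ, inv_mul_cancel_left]
      rw [stepPerm_pos _ _ _ _ _ (by rw [e]; exact hpT), e, if_pos hc, altWord, ← hu]
      refine ⟨?_, ?_⟩
      · simp only
        rw [h1, pow_succ]
        have hc' : cs.simple a * u * x.1.1 = u * x.1.1 * p := by
          rw [← hc]; simp [mul_assoc]
        rw [hc', mul_assoc _ p, ← pow_succ, ← pow_succ', mul_assoc, pow_succ, pow_succ,
          mul_assoc (p ^ k), hp, mul_one, mul_assoc]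
      · simp only
        rw [h2, pow_succ', mul_assoc]
    · have hn : x'.1.1⁻¹ * cs.simple a * x'.1.1 ∉ para cs T := by
        intro h
        apply hc
        apply hs
        rw [hconj] at h
        have := mul_mem (mul_mem (pow_mem hpT k) h) (inv_mem (pow_mem hpT k))
        simpa [mul_assoc] using this
      rw [stepPerm_neg _ _ _ _ _ hn, if_neg hc, altWord, ← hu, add_zero]
      refine ⟨?_, h2⟩
      simp only
      rw [h1]; simp only [mul_assoc]

lemma walk_fixed (a b : B) (x : St cs T A)
    (ha : x.1.1⁻¹ * cs.simple a * x.1.1 ∈ para cs T)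
    (hb : x.1.1⁻¹ * cs.simple b * x.1.1 ∈ para cs T) (m : ℕ) :
    altWord (stepPerm cs T lab a) (stepPerm cs T lab b) m x =
      (x.1, altWord (lab (x.1.1⁻¹ * cs.simple a * x.1.1)) (lab (x.1.1⁻¹ * cs.simple b * x.1.1)) m
        * x.2) := by
  induction m generalizing a b with
  | zero => simp [altWord]
  | succ m ih =>
    rw [altWord, Equiv.Perm.mul_apply, ih b a hb ha,
      stepPerm_pos cs T lab a (x.1, altWord (lab (x.1.1⁻¹ * cs.simple b * x.1.1))
        (lab (x.1.1⁻¹ * cs.simple a * x.1.1)) m * x.2) ha, altWord, mul_assoc (lab _) _ x.2]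


lemma step_relation (a b : B) (hab : a ≠ b) (h0 : M a b ≠ 0)
    (hlab : ∀ p ∈ T, ∀ q ∈ T, p ≠ q →
      orderOf (cs.simple p * cs.simple q) = M a b →
      altWord (lab (cs.simple p)) (lab (cs.simple q)) (M a b) =
        altWord (lab (cs.simple q)) (lab (cs.simple p)) (M a b)) :
    altWord (stepPerm cs T lab a) (stepPerm cs T lab b) (M a b) =
      altWord (stepPerm cs T lab b) (stepPerm cs T lab a) (M a b) := by
  ext1 x
  rcases kilmoyer cs x.1.2 a b rfl with ⟨p, hp, hstay⟩ | hfix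
  · obtain ⟨p, hp, hstay, hpT⟩ : ∃ p : W, p * p = 1 ∧ (∀ c ∈ ({a, b} : Set B), ∀ u ∈ para cs {a, b},
        x.1.1⁻¹ * (u⁻¹ * cs.simple c * u) * x.1.1 ∈ para cs T →
        x.1.1⁻¹ * (u⁻¹ * cs.simple c * u) * x.1.1 = p) ∧ p ∈ para cs T := by
      by_cases hpT : p ∈ para cs T
      · exact ⟨p, hp, hstay, hpT⟩
      · refine ⟨1, by simp, ?_, one_mem _⟩
        intro c hc u hu hmem
        have := hstay c hc u hu hmem
        rw [this] at hmem
        exact absurd hmem hpT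
    have hw1 := walk_single cs T lab a b x p hp hstay hpT (M a b)
    have hw2 := walk_single cs T lab b a x p hp (by rwa [Set.pair_comm]) hpT (M a b)
    have e1 := altWord_eq_of_pow (cs.simple a) (cs.simple b) (cs.inv_simple a) (cs.inv_simple b) _
      (cs.simple_mul_simple_pow a b)
    have e2 := cnt_symm (fun r => x.1.1⁻¹ * r * x.1.1 = p) (cs.simple a) (cs.simple b)
      (cs.inv_simple a) (cs.inv_simple b) _ (cs.simple_mul_simple_pow a b)
    refine Prod.ext (Subtype.ext ?_) ?_
    · rw [hw1.1, hw2.1, e1, e2]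
    · rw [hw1.2, hw2.2, e2]
  · have ha := hfix a (by simp)
    have hb := hfix b (by simp)
    rw [walk_fixed cs T lab a b x ha hb, walk_fixed cs T lab b a x hb ha]
    obtain ⟨p, hp, hpe⟩ := stay_simple cs x.1.2 ha
    obtain ⟨q, hq, hqe⟩ := stay_simple cs x.1.2 hb
    rw [hpe, hqe]
    have hord : orderOf (cs.simple p * cs.simple q) = M a b := by
      rw [← orderOf_simple_mul M cs a b hab h0, ← hpe, ← hqe]
      have e : x.1.1⁻¹ * cs.simple a * x.1.1 * (x.1.1⁻¹ * cs.simple b * x.1.1) =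
          MulAut.conj x.1.1⁻¹ (cs.simple a * cs.simple b) := by
        simp [MulAut.conj_apply, mul_assoc]
      rw [e]
      exact orderOf_injective (MulAut.conj x.1.1⁻¹).toMonoidHom (MulAut.conj x.1.1⁻¹).injective _
    by_cases hpq : p = q
    · rw [hpq]
    · rw [hlab p hp q hq hpq hord]

lemma isMin_one : IsMin cs T 1 := fun r _ => N_one cs r

end Action
end ArtinAux

namespace ArtinAux

/-- The Coxeter matrix attached to the exponents. -/
noncomputable def coxM {S : Type*} (M : S → S → ℕ∞) (hsymm : ∀ a b : S, M a b = M b a)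
    (htwo : ∀ a b : S, a ≠ b → 2 ≤ M a b) : CoxeterMatrix S where
  M := open Classical in fun a b => if a = b then 1 else (M a b).toNat
  isSymm := by
    ext a b
    by_cases h : a = b
    · subst h; rfl
    · exact (if_neg (Ne.symm h)).trans (((if_neg h).trans (by rw [hsymm a b])).symm)
  diagonal := by simp
  off_diagonal := by
    intro a b hab h
    simp only [hab, if_false] at h
    have h2 := htwo a b hab
    cases hM : M a b with
    | top => rw [hM] at h; simp at h
    | coe k =>
      rw [hM] at h h2
      simp at h
      rw [h] at h2
      exact absurd h2 (by decide)

lemma coxM_apply {S : Type*} (M : S → S → ℕ∞) (hsymm : ∀ a b : S, M a b = M b a)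
    (htwo : ∀ a b : S, a ≠ b → 2 ≤ M a b) (a b : S) (hab : a ≠ b) (k : ℕ) (hk : M a b = k) :
    coxM M hsymm htwo a b = k := by
  classical
  have h : coxM M hsymm htwo a b = (M a b).toNat := if_neg hab
  rw [h, hk]; rfl

end ArtinAux

/-- For a two-dimensional Artin group `A_S` and `s ≠ t` in `S` with `m_{st} = n < ∞`,
the natural homomorphism from the dihedral Artin group
`A_{st} = ⟨s, t | prod(s,t;n) = prod(t,s;n)⟩` to `A_S` sending generator to generator
is injective. -/
theorem artin_dihedral_injective {S : Type*} [Fintype S] (M : S → S → ℕ∞)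
    (hsymm : ∀ a b : S, M a b = M b a) (htwo : ∀ a b : S, a ≠ b → 2 ≤ M a b)
    (h2dim : TwoDimensional M) (s t : S) (hst : s ≠ t)
    (n : ℕ) (hn : M s t = (n : ℕ∞))
    (f : DihedralArtin n →* ArtinGroup M)
    (hfs : f (PresentedGroup.of false) = PresentedGroup.of s)
    (hft : f (PresentedGroup.of true) = PresentedGroup.of t) :
    Function.Injective f := by
  classical
  set C := ArtinAux.coxM M hsymm htwo with hC
  set cs := C.toCoxeterSystem with hcs
  have hk0 : ∀ a b : S, a ≠ b → ∀ k : ℕ, M a b = k → k ≠ 0 := by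
    intro a b hab k hk h0
    have := htwo a b hab
    rw [hk, h0] at this
    exact absurd this (by decide)
  have hCst : C s t = n := ArtinAux.coxM_apply M hsymm htwo s t hst n hn
  have hn0 := hk0 s t hst n hn
  have hordst : orderOf (cs.simple s * cs.simple t) = n := by
    rw [ArtinAux.orderOf_simple_mul C cs s t hst (by rw [hCst]; exact hn0), hCst]
  have hordts : orderOf (cs.simple t * cs.simple s) = n := by
    rw [ArtinAux.orderOf_simple_mul C cs t s hst.symm (by rw [C.symmetric, hCst]; exact hn0),
      C.symmetric, hCst]
  have hsne : cs.simple t ≠ cs.simple s := by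
    intro h
    rw [h, cs.simple_mul_simple_self, orderOf_one] at hordst
    have := htwo s t hst
    rw [hn, ← hordst] at this
    exact absurd this (by decide)
  -- the relation in the dihedral group
  have hrel : altWord (PresentedGroup.of false : DihedralArtin n) (PresentedGroup.of true) n =
      altWord (PresentedGroup.of true : DihedralArtin n) (PresentedGroup.of false) n := by
    have h1 : PresentedGroup.mk (dihedralRels n)
        (altWord (FreeGroup.of false) (FreeGroup.of true) n *
          (altWord (FreeGroup.of true) (FreeGroup.of false) n)⁻¹) = 1 :=
      PresentedGroup.one_of_mem (by simp [dihedralRels])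
    rw [map_mul, map_inv, mul_inv_eq_one, ArtinAux.altWord_map, ArtinAux.altWord_map] at h1
    exact h1
  let T : Set S := {s, t}
  let lab : C.Group → DihedralArtin n := fun w =>
    if w = cs.simple s then PresentedGroup.of false else PresentedGroup.of true
  have hls : lab (cs.simple s) = PresentedGroup.of false := if_pos rfl
  have hlt : lab (cs.simple t) = PresentedGroup.of true := if_neg hsne
  have hstep : ∀ a b : S, a ≠ b → ∀ k : ℕ, M a b = k →
      altWord (ArtinAux.stepPerm cs T lab a) (ArtinAux.stepPerm cs T lab b) k =
      altWord (ArtinAux.stepPerm cs T lab b) (ArtinAux.stepPerm cs T lab a) k := by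
    intro a b hab k hk
    have hCab : C a b = k := ArtinAux.coxM_apply M hsymm htwo a b hab k hk
    have h := ArtinAux.step_relation cs T lab a b hab (by rw [hCab]; exact hk0 a b hab k hk) ?_
    · rw [hCab] at h; exact h
    · intro p hp q hq hpq hord
      rw [← hord]
      rcases hp with rfl | hp <;> rcases hq with rfl | hq
      · exact absurd rfl hpq
      · rw [Set.mem_singleton_iff] at hq
        subst hq
        rw [hordst, hls, hlt, hrel]
      · rw [Set.mem_singleton_iff] at hp
        subst hp
        rw [hordts, hls, hlt, hrel]
      · rw [Set.mem_singleton_iff] at hp hq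
        exact absurd (hp.trans hq.symm) hpq
  have hlift : ∀ r ∈ artinRels M, FreeGroup.lift (ArtinAux.stepPerm cs T lab) r = 1 := by
    rintro r ⟨a, b, hab, k, hk, rfl⟩
    rw [map_mul, map_inv, mul_inv_eq_one, ArtinAux.altWord_map, ArtinAux.altWord_map]
    simp only [FreeGroup.lift_apply_of]
    exact hstep a b hab k hk
  let Φ : ArtinGroup M →* Equiv.Perm (ArtinAux.St cs T (DihedralArtin n)) :=
    PresentedGroup.toGroup hlift
  let y1 : {y : C.Group // ArtinAux.IsMin cs T y} := ⟨1, ArtinAux.isMin_one cs T⟩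
  have hgen : ∀ c : Bool, ∀ g : DihedralArtin n,
      Φ (f (PresentedGroup.of c)) (y1, g) = (y1, PresentedGroup.of c * g) := by
    intro c g
    cases c with
    | false =>
      rw [hfs]
      have h1 : Φ (PresentedGroup.of s) = ArtinAux.stepPerm cs T lab s :=
        PresentedGroup.toGroup.of hlift
      have hm : cs.simple s ∈ ArtinAux.para cs T := ArtinAux.simple_mem_para cs (by simp [T])
      rw [h1, ArtinAux.stepPerm_pos cs T lab s (y1, g) (by simpa [y1] using hm)]
      simp [y1, hls]
    | true =>
      rw [hft]
      have h1 : Φ (PresentedGroup.of t) = ArtinAux.stepPerm cs T lab t :=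
        PresentedGroup.toGroup.of hlift
      have hm : cs.simple t ∈ ArtinAux.para cs T := ArtinAux.simple_mem_para cs (by simp [T])
      rw [h1, ArtinAux.stepPerm_pos cs T lab t (y1, g) (by simpa [y1] using hm)]
      simp [y1, hlt]
  have hall : ∀ u g : DihedralArtin n, Φ (f u) (y1, g) = (y1, u * g) := by
    intro u
    obtain ⟨w, rfl⟩ := PresentedGroup.mk_surjective _ u
    induction w using FreeGroup.induction_on with
    | C1 => intro g; simp
    | of c => intro g; exact hgen c g
    | inv_of c ih =>
      intro g
      rw [map_inv, map_inv, map_inv, Equiv.Perm.inv_eq_iff_eq]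
      have := hgen c ((PresentedGroup.of c)⁻¹ * g)
      rw [mul_inv_cancel_left] at this
      exact this.symm
    | mul x y hx hy =>
      intro g
      rw [map_mul, map_mul, map_mul, Equiv.Perm.mul_apply, hy, hx, mul_assoc]
  intro u v huv
  have h1 := hall u 1
  have h2 := hall v 1
  rw [huv, h2] at h1
  have := congrArg Prod.snd h1
  simpa using this.symm
end

section
/- Let G be a torsion-free group containing a subgroup of finite index isomorphic to ℤ × ℤ. Then G is isomorphic to ℤ × ℤ or to the fundamental group of the Klein bottle, i.e., to the presented group ⟨a, b | a b a^{-1} = b^{-1}⟩. -/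
/-- The Klein bottle group `⟨a, b | a b a⁻¹ = b⁻¹⟩`,
with `false` playing the role of `a` and `true` the role of `b`. -/
abbrev KleinBottleGroup : Type :=
  PresentedGroup ({FreeGroup.of false * FreeGroup.of true *
    (FreeGroup.of false)⁻¹ * FreeGroup.of true} : Set (FreeGroup Bool))

theorem kb_swap {G : Type*} [Group G] {a b : G} (h : a * b * a⁻¹ * b = 1) (k j : ℤ) :
    ∃ e : ℤ, b ^ j * a ^ k = a ^ k * b ^ e := by
  have h1 : SemiconjBy a b b⁻¹ := by
    have : a * b * a⁻¹ = b⁻¹ := eq_inv_of_mul_eq_one_left h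
    unfold SemiconjBy
    rw [← this]; group
  have h2 : ∀ e : ℤ, b ^ e * a = a * b ^ (-e) := by
    intro e
    have := (h1.zpow_right (-e)).eq
    rw [this]; simp
  have h3 : ∀ e : ℤ, b ^ e * a⁻¹ = a⁻¹ * b ^ (-e) := by
    intro e
    have := h2 (-e)
    rw [neg_neg] at this
    rw [eq_inv_mul_iff_mul_eq, ← mul_assoc, ← this]; group
  induction k using Int.induction_on with
  | zero => exact ⟨j, by simp⟩
  | succ k ih =>
    obtain ⟨e, he⟩ := ih
    exact ⟨-e, by rw [zpow_add_one, ← mul_assoc, he, mul_assoc, h2, mul_assoc]⟩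
  | pred k ih =>
    obtain ⟨e, he⟩ := ih
    exact ⟨-e, by rw [zpow_sub_one, ← mul_assoc, he, mul_assoc, h3, mul_assoc]⟩

theorem klein_nf (x : KleinBottleGroup) :
    ∃ i j : ℤ, x = (PresentedGroup.of false : KleinBottleGroup) ^ i *
      (PresentedGroup.of true : KleinBottleGroup) ^ j := by
  set a : KleinBottleGroup := PresentedGroup.of false with ha
  set b : KleinBottleGroup := PresentedGroup.of true with hb
  have h : a * b * a⁻¹ * b = 1 := PresentedGroup.one_of_mem (Set.mem_singleton _)
  let S : Subgroup KleinBottleGroup :=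
    { carrier := {x | ∃ i j : ℤ, x = a ^ i * b ^ j}
      one_mem' := ⟨0, 0, by simp⟩
      mul_mem' := by
        rintro _ _ ⟨i, j, rfl⟩ ⟨k, l, rfl⟩
        obtain ⟨e, he⟩ := kb_swap h k j
        refine ⟨i + k, e + l, ?_⟩
        rw [zpow_add, zpow_add, mul_assoc, ← mul_assoc (b ^ j), he]
        simp only [mul_assoc]
      inv_mem' := by
        rintro _ ⟨i, j, rfl⟩
        obtain ⟨e, he⟩ := kb_swap h (-i) (-j)
        exact ⟨-i, e, by rw [← he]; simp⟩ }
  refine PresentedGroup.generated_by _ S ?_ x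
  rintro (_ | _)
  · exact ⟨1, 0, by simp [ha]⟩
  · exact ⟨0, 1, by simp [hb]⟩

theorem klein_iso {G : Type*} [Group G] (g v : G) (hrel : g * v * g⁻¹ * v = 1)
    (hgen : ∀ x : G, ∃ i j : ℤ, x = g ^ i * v ^ j)
    (hind : ∀ i j : ℤ, g ^ i * v ^ j = 1 → i = 0 ∧ j = 0) :
    Nonempty (G ≃* KleinBottleGroup) := by
  let f : Bool → G := fun t => if t then v else g
  have hf : ∀ r ∈ ({FreeGroup.of false * FreeGroup.of true *
    (FreeGroup.of false)⁻¹ * FreeGroup.of true} : Set (FreeGroup Bool)),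
      FreeGroup.lift f r = 1 := by
    intro r hr
    rw [Set.mem_singleton_iff.1 hr]
    simpa [f] using hrel
  let φ : KleinBottleGroup →* G := PresentedGroup.toGroup hf
  have hφ : ∀ i j : ℤ, φ ((PresentedGroup.of false : KleinBottleGroup) ^ i *
      (PresentedGroup.of true : KleinBottleGroup) ^ j) = g ^ i * v ^ j := by
    intro i j
    simp [φ, f]
  refine ⟨(MulEquiv.ofBijective φ ⟨?_, ?_⟩).symm⟩
  · rw [injective_iff_map_eq_one]
    intro x hx
    obtain ⟨i, j, rfl⟩ := klein_nf x
    rw [hφ] at hx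
    obtain ⟨rfl, rfl⟩ := hind i j hx
    simp
  · intro x
    obtain ⟨i, j, rfl⟩ := hgen x
    exact ⟨_, hφ i j⟩

theorem mat_unip (A : Matrix (Fin 2) (Fin 2) ℤ) (n : ℕ) (hn : 0 < n) (hA : A ^ n = 1)
    (hd : A.det = 1) (hs : (A - 1).det = 0) : A = 1 := by
  have hsq : (A - 1) * (A - 1) = 0 := by
    simp only [Matrix.det_fin_two, Matrix.sub_apply] at hd hs
    simp at hs
    ext i j
    fin_cases i <;> fin_cases j <;> simp [Matrix.mul_apply, Fin.sum_univ_two] <;> grind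
  have hp : ∀ k : ℕ, A ^ k = 1 + (k : ℤ) • (A - 1) := by
    intro k
    induction k with
    | zero => simp
    | succ k ih =>
      have : A ^ (k + 1) = A ^ k + A ^ k * (A - 1) := by rw [pow_succ]; noncomm_ring
      rw [this, ih, add_mul, smul_mul_assoc, hsq]
      push_cast
      simp [add_smul, add_assoc]
  have := hp n
  rw [hA] at this
  have h0 : (n : ℤ) • (A - 1) = 0 := by simpa using this.symm
  rcases smul_eq_zero.1 h0 with h | h
  · omega
  · exact sub_eq_zero.1 h

theorem lin_unip {M : Type*} [AddCommGroup M] [Module.Free ℤ M] [Module.Finite ℤ M]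
    (h2 : Module.finrank ℤ M = 2) (A : Module.End ℤ M) (n : ℕ) (hn : 0 < n) (hA : A ^ n = 1)
    (hd : LinearMap.det A = 1) (v : M) (hv : v ≠ 0) (hAv : A v = v) : A = 1 := by
  let b := Module.finBasisOfFinrankEq ℤ M h2
  let e := LinearMap.toMatrixAlgEquiv b
  apply e.injective
  rw [map_one]
  have hdet : ∀ B : Module.End ℤ M, (e B).det = LinearMap.det B := fun B => by
    exact LinearMap.det_toMatrix b B
  refine mat_unip (e A) n hn (by rw [← map_pow, hA, map_one]) (by rw [hdet, hd]) ?_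
  rw [← map_one e, ← map_sub, hdet]
  by_contra hne
  have hv0 : (A - 1) v = 0 := by simp [hAv]
  rw [← hdet] at hne
  have hm : (e (A - 1)).mulVec (b.repr v) = b.repr ((A - 1) v) :=
    LinearMap.toMatrix_mulVec_repr b b (A - 1) v
  rw [hv0, map_zero] at hm
  have h0 := Matrix.eq_zero_of_mulVec_eq_zero hne hm
  apply hv
  apply b.repr.injective
  rw [map_zero]
  exact DFunLike.coe_injective h0

theorem rank_one_gen {M : Type*} [AddCommGroup M] [Module.Free ℤ M] [Module.Finite ℤ M]
    (h : Module.finrank ℤ M = 1) : ∃ u : M, ∀ x : M, ∃ k : ℤ, x = k • u := by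
  let b := Module.finBasisOfFinrankEq ℤ M h
  refine ⟨b 0, fun x => ⟨b.repr x 0, ?_⟩⟩
  conv_lhs => rw [← b.sum_repr x]
  simp

theorem split_gen {M : Type*} [AddCommGroup M] [Module.Free ℤ M] [Module.Finite ℤ M]
    (h2 : Module.finrank ℤ M = 2) (P Q : Submodule ℤ M) (hPQ : P ⊓ Q = ⊥)
    (hP : P ≠ ⊥) (hQ : Q ≠ ⊥) :
    (∃ u ∈ P, ∀ x ∈ P, ∃ k : ℤ, x = k • u) ∧ (∃ u ∈ Q, ∀ x ∈ Q, ∃ k : ℤ, x = k • u) := by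
  have hinj : Function.Injective (P.subtype.coprod Q.subtype) := by
    rw [injective_iff_map_eq_zero]
    rintro ⟨⟨x, hx⟩, ⟨y, hy⟩⟩ h
    simp at h
    have hxy : x = -y := eq_neg_of_add_eq_zero_left h
    have : x ∈ P ⊓ Q := ⟨hx, hxy ▸ Q.neg_mem hy⟩
    rw [hPQ, Submodule.mem_bot] at this
    subst this
    simp at h
    simp [h]
  have hle := LinearMap.finrank_le_finrank_of_injective hinj
  rw [Module.finrank_prod, h2] at hle
  have hP' : Module.finrank ℤ P ≠ 0 := fun h => hP (Submodule.finrank_eq_zero.1 h)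
  have hQ' : Module.finrank ℤ Q ≠ 0 := fun h => hQ (Submodule.finrank_eq_zero.1 h)
  have aux : ∀ R : Submodule ℤ M, Module.finrank ℤ R = 1 →
      ∃ u ∈ R, ∀ x ∈ R, ∃ k : ℤ, x = k • u := by
    intro R hR
    obtain ⟨u, hu⟩ := rank_one_gen hR
    refine ⟨u, u.2, fun x hx => ?_⟩
    obtain ⟨k, hk⟩ := hu ⟨x, hx⟩
    exact ⟨k, congrArg Subtype.val hk⟩
  exact ⟨aux P (by omega), aux Q (by omega)⟩

theorem main_lattice {G M : Type*} [Group G] [AddCommGroup M] [Module.Free ℤ M]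
    [Module.Finite ℤ M] (h2 : Module.finrank ℤ M = 2)
    (htf : ∀ g : G, IsOfFinOrder g → g = 1)
    (ι : M → G) (hadd : ∀ x y, ι (x + y) = ι x * ι y) (hinj : Function.Injective ι)
    (ρ : G →* Module.End ℤ M) (hρ : ∀ g m, ι (ρ g m) = g * ι m * g⁻¹)
    (hfaith : ∀ g, ρ g = 1 → ∃ m, ι m = g)
    (hfin : ∀ g : G, ∃ n : ℕ, 0 < n ∧ ∃ m, ι m = g ^ n) :
    Nonempty (G ≃* Multiplicative (ℤ × ℤ)) ∨ Nonempty (G ≃* KleinBottleGroup) := by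
  let j : Multiplicative M →* G :=
    MonoidHom.mk' (fun x => ι x.toAdd) (fun x y => hadd x.toAdd y.toAdd)
  have h0 : ι 0 = 1 := map_one j
  have hz : ∀ (k : ℤ) (x : M), ι (k • x) = ι x ^ k :=
    fun k x => map_zpow j (Multiplicative.ofAdd x) k
  have hneg : ∀ x : M, ι (-x) = (ι x)⁻¹ := fun x => map_inv j (Multiplicative.ofAdd x)
  have hcomm : ∀ x y, ι x * ι y = ι y * ι x := fun x y => by rw [← hadd, ← hadd, add_comm]
  have hker : ∀ m, ρ (ι m) = 1 := by
    intro m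
    ext x
    apply hinj
    rw [hρ, hcomm]
    simp
  have htf' : ∀ (g : G) (n : ℕ), 0 < n → g ^ n = 1 → g = 1 := fun g n hn h =>
    htf g (isOfFinOrder_iff_pow_eq_one.2 ⟨n, hn, h⟩)
  have key : ∀ g, LinearMap.det (ρ g) = 1 → ∃ m, ι m = g := by
    intro g hd
    obtain ⟨n, hn, m, hm⟩ := hfin g
    by_cases hm0 : m = 0
    · subst hm0
      exact ⟨0, by rw [h0, htf' g n hn (by rw [← hm, h0])]⟩
    · apply hfaith
      refine lin_unip h2 (ρ g) n hn (by rw [← map_pow, ← hm, hker]) hd m hm0 ?_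
      apply hinj
      rw [hρ, hm, ← pow_succ', pow_succ, mul_inv_cancel_right]
  have hunit : ∀ g, LinearMap.det (ρ g) = 1 ∨ LinearMap.det (ρ g) = -1 := by
    intro g
    have : LinearMap.det (ρ g) * LinearMap.det (ρ g⁻¹) = 1 := by
      rw [← map_mul, ← map_mul, mul_inv_cancel, map_one, map_one]
    exact Int.eq_one_or_neg_one_of_mul_eq_one this
  by_cases hall : ∀ g, ∃ m, ι m = g
  · left
    have e1 : Multiplicative M ≃* G := MulEquiv.ofBijective j ⟨hinj, hall⟩
    have e2 : M ≃ₗ[ℤ] (ℤ × ℤ) := LinearEquiv.ofFinrankEq M (ℤ × ℤ) (by simp [h2])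
    exact ⟨e1.symm.trans (AddEquiv.toMultiplicative e2.toAddEquiv)⟩
  right
  push Not at hall
  obtain ⟨g₀, hg₀⟩ := hall
  have hdet : ∀ g, (∀ m, ι m ≠ g) → LinearMap.det (ρ g) = -1 := by
    intro g hg
    refine (hunit g).resolve_left fun h => ?_
    obtain ⟨m, hm⟩ := key g h
    exact hg m hm
  have hprod : ∀ g h, (∀ m, ι m ≠ g) → (∀ m, ι m ≠ h) → ∃ m, ι m = g * h := by
    intro g h hg hh
    apply key
    rw [map_mul, map_mul, hdet g hg, hdet h hh]
    norm_num
  have hg₀' : ∀ m, ι m ≠ g₀⁻¹ := by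
    intro m hm
    exact hg₀ (-m) (by rw [hneg, hm, inv_inv])
  obtain ⟨c, hc⟩ := hprod g₀ g₀ hg₀ hg₀
  obtain ⟨A, hA⟩ : ∃ A, A = ρ g₀ := ⟨_, rfl⟩
  have hAA : ∀ x, A (A x) = x := by
    intro x
    have : A * A = 1 := by rw [hA, ← map_mul, ← hc, hker]
    exact LinearMap.congr_fun this x
  have hAc : A c = c := by
    apply hinj
    rw [hA, hρ, hc]
    group
  have hc0 : c ≠ 0 := by
    rintro rfl
    have : g₀ = 1 := htf' g₀ 2 (by norm_num) (by rw [pow_two, ← hc, h0])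
    exact hg₀ 0 (by rw [h0, this])
  have hA1 : A ≠ 1 := by
    intro h
    obtain ⟨m, hm⟩ := hfaith g₀ (by rw [← hA, h])
    exact hg₀ m hm
  have htwo : ∀ x : M, x = -x → x = 0 := by
    intro x hx
    have h3 : (2 : ℤ) • x = 0 := by
      rw [two_smul]
      exact eq_neg_iff_add_eq_zero.1 hx
    exact (smul_eq_zero.1 h3).resolve_left two_ne_zero
  obtain ⟨⟨u, hu, hPu⟩, ⟨w, hw, hQw⟩⟩ := split_gen h2 (LinearMap.ker (A - 1))
    (LinearMap.ker (A + 1)) (by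
      rw [eq_bot_iff]
      rintro x ⟨hx, hx'⟩
      have hx1 : A x - x = 0 := hx
      have hx2 : A x + x = 0 := hx'
      apply htwo
      rw [← sub_eq_zero.1 hx1]
      rw [sub_eq_zero.1 hx1]
      rw [sub_eq_zero.1 hx1] at hx2
      exact eq_neg_of_add_eq_zero_left hx2) (by
      rw [Submodule.ne_bot_iff]
      exact ⟨c, by simp [hAc], hc0⟩) (by
      rw [Submodule.ne_bot_iff]
      by_contra! hcon
      apply hA1
      ext x
      have := hcon (A x - x) (by simp [hAA])
      exact sub_eq_zero.1 this)
  have hu : A u = u := sub_eq_zero.1 (show A u - u = 0 from hu)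
  have hw : A w = -w := eq_neg_of_add_eq_zero_left (show A w + w = 0 from hw)
  have hP : ∀ x, A x = x → ∃ k : ℤ, x = k • u := fun x hx => hPu x (by simp [hx])
  have hQ : ∀ x, A x = -x → ∃ k : ℤ, x = k • w := fun x hx => hQw x (by simp [hx])
  have hu0 : u ≠ 0 := by
    rintro rfl
    obtain ⟨k, hk⟩ := hP c hAc
    exact hc0 (by simpa using hk)
  have hw0 : w ≠ 0 := by
    rintro rfl
    apply hA1
    ext x
    obtain ⟨k, hk⟩ := hQ (A x - x) (by simp [hAA])
    rw [smul_zero] at hk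
    exact sub_eq_zero.1 hk
  have hsq : ∀ x, (g₀ * ι x) * (g₀ * ι x) = ι (A x + c + x) := by
    intro x
    rw [hadd, hadd, hA, hρ, hc]
    group
  have hno : ∀ x, A x + c + x ≠ 0 := by
    intro x hx
    have h1 : g₀ * ι x = 1 := htf' _ 2 (by norm_num) (by rw [pow_two, hsq, hx, h0])
    exact hg₀ (-x) (by rw [hneg, eq_inv_of_mul_eq_one_left h1])
  obtain ⟨k, hk⟩ := hP c hAc
  obtain ⟨l, hl⟩ : ∃ l, k = 2 * l + 1 := by
    rcases Int.even_or_odd' k with ⟨l, hl | hl⟩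
    · exfalso
      apply hno ((-l) • u)
      rw [map_zsmul, hu, hk, hl]
      module
    · exact ⟨l, hl⟩
  have hdecomp : ∀ x, ∃ t s : ℤ, x = t • u + s • w := by
    intro x
    obtain ⟨m, hm⟩ := hP (A x + x) (by rw [map_add, hAA, add_comm])
    have hAx : A x = m • u - x := eq_sub_of_add_eq hm
    rcases Int.even_or_odd' m with ⟨t, ht | ht⟩
    · obtain ⟨s, hs⟩ := hQ (x - t • u) (by
        rw [map_sub, map_zsmul, hu, hAx, ht]
        module)
      exact ⟨t, s, by rw [← hs]; abel⟩
    · exfalso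
      apply hno (x - (t + l + 1) • u)
      rw [map_sub, map_zsmul, hu, hAx, hk, hl, ht]
      module
  obtain ⟨g, hg⟩ : ∃ g, g = g₀ * ι ((-l) • u) := ⟨_, rfl⟩
  have hgg : g * g = ι u := by
    rw [hg, hsq, map_zsmul, hu, hk, hl]
    congr 1
    module
  have hρg : ρ g = A := by rw [hg, map_mul, hker, mul_one, hA]
  have hgr : ∀ m, ι m ≠ g := by
    intro m hm
    apply hg₀ (m - (-l) • u)
    rw [sub_eq_add_neg, hadd, hneg, hm, hg, mul_inv_cancel_right]
  have hgi : ∀ m, ι m ≠ g⁻¹ := by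
    intro m hm
    exact hgr (-m) (by rw [hneg, hm, inv_inv])
  have hev : ∀ t s : ℤ, g ^ (2 * t) * ι w ^ s = ι (t • u + s • w) := by
    intro t s
    rw [hadd, hz, hz, ← hgg, zpow_mul]
    congr 2
    exact_mod_cast pow_two g
  refine klein_iso g (ι w) ?_ ?_ ?_
  · rw [← hρ, hρg, hw, ← hadd, neg_add_cancel, h0]
  · intro x
    by_cases hx : ∃ m, ι m = x
    · obtain ⟨m, rfl⟩ := hx
      obtain ⟨t, s, rfl⟩ := hdecomp m
      exact ⟨2 * t, s, (hev t s).symm⟩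
    · push Not at hx
      obtain ⟨m, hm⟩ := hprod g⁻¹ x hgi hx
      obtain ⟨t, s, rfl⟩ := hdecomp m
      refine ⟨1 + 2 * t, s, ?_⟩
      rw [zpow_add, mul_assoc, hev, hm]
      simp
  · intro i s his
    rcases Int.even_or_odd' i with ⟨t, rfl | rfl⟩
    · rw [hev, ← h0] at his
      have h1 := hinj his
      have h3 : t • u - s • w = 0 := by
        have := congrArg A h1
        rw [map_add, map_zsmul, map_zsmul, hu, hw, map_zero] at this
        rw [← this]; module
      have h4 : t • u = 0 := by
        apply htwo
        rw [eq_neg_iff_add_eq_zero]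
        calc t • u + t • u = (t • u + s • w) + (t • u - s • w) := by abel
          _ = 0 := by rw [h1, h3, add_zero]
      have h5 : s • w = 0 := by rw [h4, zero_add] at h1; exact h1
      have ht := (smul_eq_zero.1 h4).resolve_right hu0
      have hs := (smul_eq_zero.1 h5).resolve_right hw0
      simp [ht, hs]
    · exfalso
      rw [add_comm, zpow_add, mul_assoc, hev, zpow_one] at his
      exact hgi _ (eq_inv_of_mul_eq_one_right his)

open scoped IsMulCommutative in
theorem main_sub {G : Type*} [Group G] (htf : ∀ g : G, IsOfFinOrder g → g = 1)
    (H : Subgroup G) (hfi : H.FiniteIndex) (e : H ≃* Multiplicative (ℤ × ℤ)) :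
    Nonempty (G ≃* Multiplicative (ℤ × ℤ)) ∨ Nonempty (G ≃* KleinBottleGroup) := by
  have htf' : ∀ (g : G) (n : ℕ), n ≠ 0 → g ^ n = 1 → g = 1 := fun g n hn h =>
    htf g (isOfFinOrder_iff_pow_eq_one.2 ⟨n, Nat.pos_of_ne_zero hn, h⟩)
  have hHc : ∀ x ∈ H, ∀ y ∈ H, x * y = y * x := by
    intro x hx y hy
    have : (⟨x, hx⟩ : H) * ⟨y, hy⟩ = ⟨y, hy⟩ * ⟨x, hx⟩ := by
      apply e.injective
      rw [map_mul, map_mul, mul_comm]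
    exact congrArg Subtype.val this
  obtain ⟨N, hN⟩ : ∃ N, N = H.normalCore := ⟨_, rfl⟩
  have hNH : N ≤ H := hN ▸ H.normalCore_le
  have : N.Normal := hN ▸ H.normalCore_normal
  have hNf : N.FiniteIndex := by rw [hN]; infer_instance
  obtain ⟨K, hK⟩ : ∃ K : Subgroup G, K = Subgroup.centralizer (N : Set G) := ⟨_, rfl⟩
  have : K.Normal := by rw [hK]; infer_instance
  have hmemK : ∀ x, x ∈ K ↔ ∀ n ∈ N, n * x = x * n := by
    intro x
    rw [hK, Subgroup.mem_centralizer_iff]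
    rfl
  have hNK : N ≤ K := by
    intro x hx
    rw [hmemK]
    exact fun n hn => hHc n (hNH hn) x (hNH hx)
  have hcen : N.subgroupOf K ≤ Subgroup.center K := by
    intro x hx
    rw [Subgroup.mem_center_iff]
    intro y
    apply Subtype.ext
    exact (((hmemK y.1).1 y.2) x.1 hx).symm
  have : (Subgroup.center K).FiniteIndex := Subgroup.finiteIndex_of_le hcen
  have hKc : IsMulCommutative K := by
    refine IsMulCommutative.of_comm fun a b => ?_
    have h1 : MonoidHom.transferCenterPow K (a * b * a⁻¹ * b⁻¹) = 1 := by
      rw [map_mul, map_mul, map_mul, map_inv, map_inv]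
      apply Subtype.ext
      have := (Subgroup.mem_center_iff.1 (MonoidHom.transferCenterPow K b).2)
        (MonoidHom.transferCenterPow K a : K)
      push_cast
      rw [this]
      group
    have h3 := congrArg Subtype.val (congrArg Subtype.val h1)
    have h4 := htf' _ _ Subgroup.FiniteIndex.index_ne_zero h3
    have h5 : a * b * a⁻¹ * b⁻¹ = 1 := Subtype.ext h4
    rw [mul_inv_eq_one, mul_inv_eq_iff_eq_mul] at h5
    exact h5
  have hn0 : N.index ≠ 0 := Subgroup.FiniteIndex.index_ne_zero
  -- the module structure
  let f1 : K →* H := MonoidHom.mk' (fun x => ⟨x.1 ^ N.index, hNH (N.pow_index_mem x.1)⟩) (by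
    intro a b
    apply Subtype.ext
    have : Commute a.1 b.1 := congrArg Subtype.val (mul_comm a b)
    exact this.mul_pow _)
  have hf1 : Function.Injective f1 := by
    rw [injective_iff_map_eq_one]
    intro a ha
    exact Subtype.ext (htf' _ _ hn0 (congrArg Subtype.val ha))
  let f2 : H →* K := MonoidHom.mk' (fun x => ⟨x.1 ^ N.index, hNK (N.pow_index_mem x.1)⟩) (by
    intro a b
    apply Subtype.ext
    have : Commute a.1 b.1 := hHc a.1 a.2 b.1 b.2
    exact this.mul_pow _)
  have hf2 : Function.Injective f2 := by
    rw [injective_iff_map_eq_one]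
    intro a ha
    exact Subtype.ext (htf' _ _ hn0 (congrArg Subtype.val ha))
  let F1 : Additive K →ₗ[ℤ] (ℤ × ℤ) :=
    (MonoidHom.toAdditiveLeft (e.toMonoidHom.comp f1)).toIntLinearMap
  have hF1 : Function.Injective F1 := e.injective.comp hf1
  let F2 : (ℤ × ℤ) →ₗ[ℤ] Additive K :=
    (MonoidHom.toAdditiveRight (f2.comp e.symm.toMonoidHom)).toIntLinearMap
  have hF2 : Function.Injective F2 := hf2.comp e.symm.injective
  have : Module.Finite ℤ (Additive K) := Module.Finite.of_injective F1 hF1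
  have : Module.IsTorsionFree ℤ (Additive K) := hF1.moduleIsTorsionFree F1 (by simp)
  have : Module.Free ℤ (Additive K) := inferInstance
  have hr : Module.finrank ℤ (Additive K) = 2 := by
    apply le_antisymm
    · simpa using LinearMap.finrank_le_finrank_of_injective hF1
    · simpa using LinearMap.finrank_le_finrank_of_injective hF2
  let ρ : G →* Module.End ℤ (Additive K) :=
    { toFun := fun g => (MonoidHom.toAdditive (MulAut.conjNormal g : MulAut K).toMonoidHom).toIntLinearMap
      map_one' := by
        ext x
        simp
      map_mul' := by
        intro a b
        ext x
        simp }
  have hρ : ∀ g (m : Additive K), ((ρ g m).toMul : G) = g * (m.toMul : G) * g⁻¹ := by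
    intro g m
    exact MulAut.conjNormal_apply g m.toMul
  refine main_lattice hr htf (fun x => (x.toMul : G)) (fun x y => rfl)
    (fun x y h => Subtype.ext h) ρ hρ ?_ ?_
  · intro g hg
    have : g ∈ K := by
      rw [hmemK]
      intro n hn
      have h1 := hρ g (Additive.ofMul (⟨n, hNK hn⟩ : K))
      rw [hg] at h1
      have h3 : n = g * n * g⁻¹ := h1
      exact eq_mul_inv_iff_mul_eq.1 h3
    exact ⟨Additive.ofMul ⟨g, this⟩, rfl⟩
  · intro g
    exact ⟨N.index, Nat.pos_of_ne_zero hn0,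
      Additive.ofMul ⟨_, hNK (N.pow_index_mem g)⟩, rfl⟩

/-- A torsion-free group containing a finite-index subgroup isomorphic to `ℤ × ℤ` is
isomorphic either to `ℤ × ℤ` or to the fundamental group of the Klein bottle. -/
theorem torsionFree_virtually_Z2 (G : Type*) [Group G]
    (htf : ∀ g : G, IsOfFinOrder g → g = 1)
    (H : Subgroup G) (hfi : H.FiniteIndex)
    (hiso : Nonempty (H ≃* Multiplicative (ℤ × ℤ))) :
    Nonempty (G ≃* Multiplicative (ℤ × ℤ)) ∨ Nonempty (G ≃* KleinBottleGroup) := by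
  obtain ⟨e⟩ := hiso
  exact main_sub htf H hfi e
end
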